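/- arXiv:0706.2647 — 7 statements merged into one kernel-verified Lean document; each statement's English description precedes it below -/
import Mathlib

section
/- Let λ ≥ 0, let X and Y be mm-spaces with μ_X(X) = μ_Y(Y), and let 0 < α ≤ 1. Then α·□̲_λ(X,Y) ≤ □̲_λ(αX, αY) ≤ □̲_λ(X,Y), where αX := (X, d_X, α·μ_X) and αY := (Y, d_Y, α·μ_Y). -/
open MeasureTheory Set Filter Topology

noncomputable section

/-- Lebesgue measure restricted to the interval `[0, m]`. -/
def lebIcc (m : ℝ) : Measure ℝ := volume.restrict (Icc 0 m)

/-- `φ : [0,m] → X` is a parameter of the mm-space `(X, d_X, μX)`: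
a Borel measurable map pushing Lebesgue measure on `[0,m]` forward to `μX`. -/
def IsParameter {X : Type*} [MeasurableSpace X] (μX : Measure X) (m : ℝ) (φ : ℝ → X) : Prop :=
  Measurable φ ∧ Measure.map φ (lebIcc m) = μX

/-- The pullback `φ*d_X` of the distance of `X` under `φ`. -/
def pb {X : Type*} [PseudoMetricSpace X] (φ : ℝ → X) : ℝ → ℝ → ℝ :=
  fun s t => dist (φ s) (φ t)

/-- The distance `□_λ(d₁, d₂)` between two maps `d₁ d₂ : α × α → ℝ` over a finite
measure space `(α, μ)`. -/
def boxDist {α : Type*} [MeasurableSpace α] (μ : Measure α) (lam : ℝ)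
    (d₁ d₂ : α → α → ℝ) : ℝ :=
  sInf {ε : ℝ | 0 < ε ∧ ∃ T : Set α, MeasurableSet T ∧
    (μ univ).toReal - lam * ε ≤ (μ T).toReal ∧
    ∀ x ∈ T, ∀ y ∈ T, |d₁ x y - d₂ x y| ≤ ε}

/-- `inf □_λ(φX*d_X, φY*d_Y)` over all parameters, for mm-spaces of equal total mass `m`. -/
def boxInf {X Y : Type*} [PseudoMetricSpace X] [MeasurableSpace X]
    [PseudoMetricSpace Y] [MeasurableSpace Y] (lam m : ℝ)
    (μX : Measure X) (μY : Measure Y) : ℝ :=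
  sInf {r : ℝ | ∃ (φX : ℝ → X) (φY : ℝ → Y), IsParameter μX m φX ∧ IsParameter μY m φY ∧
    r = boxDist (lebIcc m) lam (pb φX) (pb φY)}

open Classical in
/-- Gromov's box distance `□̲_λ(X, Y)` between mm-spaces. -/
def mmBox {X Y : Type*} [PseudoMetricSpace X] [MeasurableSpace X]
    [PseudoMetricSpace Y] [MeasurableSpace Y] (lam : ℝ)
    (μX : Measure X) (μY : Measure Y) : ℝ :=
  if (μX univ).toReal = (μY univ).toReal then
    boxInf lam (μX univ).toReal μX μY
  else if (μX univ).toReal < (μY univ).toReal then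
    boxInf lam (μX univ).toReal μX
      ((ENNReal.ofReal ((μX univ).toReal / (μY univ).toReal)) • μY)
      + ((μY univ).toReal - (μX univ).toReal)
  else
    boxInf lam (μY univ).toReal
      ((ENNReal.ofReal ((μY univ).toReal / (μX univ).toReal)) • μX) μY
      + ((μX univ).toReal - (μY univ).toReal)

/-- The measure `μ̲_r` on `r × r` real matrices: the pushforward of `μ^r` under
`(x₁, …, x_r) ↦ (d(x_i, x_j))_{i,j}`, for a (pseudo)distance `d`. -/
def matMeasure {α : Type*} [MeasurableSpace α] (μ : Measure α) (d : α → α → ℝ) (r : ℕ) :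
    Measure (Fin r → Fin r → ℝ) :=
  Measure.map (fun x : Fin r → α => fun i j => d (x i) (x j)) (Measure.pi fun _ : Fin r => μ)

/-- The support of a Borel measure. -/
def msupport {X : Type*} [TopologicalSpace X] [MeasurableSpace X] (μ : Measure X) : Set X :=
  {x | ∀ U : Set X, IsOpen U → x ∈ U → 0 < μ U}

/-- Two mm-spaces are isomorphic: there is a measure preserving isometry (bijective)
between the supports of their measures. -/
def MMIsom {X Y : Type*} [MetricSpace X] [MeasurableSpace X] [MetricSpace Y] [MeasurableSpace Y]
    (μX : Measure X) (μY : Measure Y) : Prop :=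
  ∃ f : msupport μX → msupport μY, Function.Bijective f ∧ Isometry f ∧
    Measure.map f (Measure.comap Subtype.val μX) = Measure.comap Subtype.val μY

/-- The distance `me_λ` on the space of all real valued functions on `(α, μ)`. -/
def meDist {α : Type*} [MeasurableSpace α] (μ : Measure α) (lam : ℝ) (f g : α → ℝ) : ℝ :=
  sInf {ε : ℝ | 0 < ε ∧ (μ {x | ε ≤ |f x - g x|}).toReal ≤ lam * ε}

/-- The distance `me₁` for maps into a metric space. -/
def meDistMap {α Y : Type*} [MeasurableSpace α] [PseudoMetricSpace Y]
    (μ : Measure α) (f g : α → Y) : ℝ :=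
  sInf {ε : ℝ | 0 < ε ∧ (μ {x | ε ≤ dist (f x) (g x)}).toReal ≤ ε}

/-- `Lip_1(d)`: the real valued functions that are `1`-Lipschitz w.r.t. a semi-distance `d`. -/
def Lip1 {α : Type*} (d : α → α → ℝ) : Set (α → ℝ) := {f | ∀ x y, |f x - f y| ≤ d x y}

/-- `d` is a semi-distance function. -/
structure IsSemiDist {α : Type*} (d : α → α → ℝ) : Prop where
  refl : ∀ x, d x x = 0
  symm : ∀ x y, d x y = d y x
  triangle : ∀ x y z, d x z ≤ d x y + d y z

/-- `H_λLι₁(d, d')`: the Hausdorff distance between `Lip_1(d)` and `Lip_1(d')` in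
`(𝓕(α, ℝ), me_λ)`. -/
def HL {α : Type*} [MeasurableSpace α] (μ : Measure α) (lam : ℝ) (d d' : α → α → ℝ) : ℝ :=
  sInf {ε : ℝ | 0 < ε ∧ (∀ f ∈ Lip1 d, ∃ g ∈ Lip1 d', meDist μ lam f g ≤ ε) ∧
    (∀ g ∈ Lip1 d', ∃ f ∈ Lip1 d, meDist μ lam f g ≤ ε)}

/-- `inf H_λLι₁(φX*d_X, φY*d_Y)` over all parameters, for mm-spaces of equal total mass `m`. -/
def obsInf {X Y : Type*} [PseudoMetricSpace X] [MeasurableSpace X]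
    [PseudoMetricSpace Y] [MeasurableSpace Y] (lam m : ℝ)
    (μX : Measure X) (μY : Measure Y) : ℝ :=
  sInf {r : ℝ | ∃ (φX : ℝ → X) (φY : ℝ → Y), IsParameter μX m φX ∧ IsParameter μY m φY ∧
    r = HL (lebIcc m) lam (pb φX) (pb φY)}

open Classical in
/-- Gromov's observable distance `H̲_λLι₁(X, Y)` between mm-spaces. -/
def mmObs {X Y : Type*} [PseudoMetricSpace X] [MeasurableSpace X]
    [PseudoMetricSpace Y] [MeasurableSpace Y] (lam : ℝ)
    (μX : Measure X) (μY : Measure Y) : ℝ :=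
  if (μX univ).toReal = (μY univ).toReal then
    obsInf lam (μX univ).toReal μX μY
  else if (μX univ).toReal < (μY univ).toReal then
    obsInf lam (μX univ).toReal μX
      ((ENNReal.ofReal ((μX univ).toReal / (μY univ).toReal)) • μY)
      + ((μY univ).toReal - (μX univ).toReal)
  else
    obsInf lam (μY univ).toReal
      ((ENNReal.ofReal ((μY univ).toReal / (μX univ).toReal)) • μX) μY
      + ((μX univ).toReal - (μY univ).toReal)

/-- `f : X → Y` is `λ`-Lipschitz up to `ε`. -/
def LipUpTo {X Y : Type*} [PseudoMetricSpace X] [PseudoMetricSpace Y] [MeasurableSpace X]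
    (μX : Measure X) (lam ε : ℝ) (f : X → Y) : Prop :=
  ∃ X₀ : Set X, MeasurableSet X₀ ∧ (μX X₀ᶜ).toReal ≤ ε ∧
    ∀ x ∈ X₀, ∀ x' ∈ X₀, dist (f x) (f x') ≤ lam * dist x x' + ε

/-- Weak convergence of a sequence of finite Borel measures: convergence of integrals of
all bounded continuous functions. -/
def WeakConv {Y : Type*} [TopologicalSpace Y] [MeasurableSpace Y]
    (μs : ℕ → Measure Y) (μ : Measure Y) : Prop :=
  ∀ g : BoundedContinuousFunction Y ℝ,
    Tendsto (fun n => ∫ y, g y ∂(μs n)) atTop (𝓝 (∫ y, g y ∂μ))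

/-- `X` Lipschitz dominates `Y`: there are a `1`-Lipschitz map `p : Supp μX → Supp μY` and
`c ≥ 1` with `p_*(μX) = c • μY`. -/
def LipDom {X Y : Type*} [MetricSpace X] [MeasurableSpace X] [MetricSpace Y] [MeasurableSpace Y]
    (μX : Measure X) (μY : Measure Y) : Prop :=
  ∃ (p : msupport μX → msupport μY) (c : ℝ), 1 ≤ c ∧
    (∀ a b : msupport μX, dist (p a) (p b) ≤ dist a b) ∧
    Measure.map p (Measure.comap Subtype.val μX)
      = (ENNReal.ofReal c) • Measure.comap Subtype.val μY

end

/-- Dilating the line by `c⁻¹` turns Lebesgue measure on `[0, cm]` into `c` times Lebesgue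
measure on `[0, m]`. -/
theorem map_inv_mul_lebIcc {c : ℝ} (hc : 0 < c) (m : ℝ) :
    Measure.map (fun t => c⁻¹ * t) (lebIcc (c * m)) = ENNReal.ofReal c • lebIcc m := by
  have hpre : (fun t => c⁻¹ * t) ⁻¹' Icc 0 m = Icc 0 (c * m) := by
    ext t
    simp only [mem_preimage, mem_Icc]
    rw [inv_mul_le_iff₀ hc, mul_nonneg_iff_of_pos_left (inv_pos.2 hc)]
  rw [lebIcc, lebIcc, ← hpre, ← Measure.restrict_map (measurable_const_mul _) measurableSet_Icc,
    Real.map_volume_mul_left (inv_pos.2 hc).ne', inv_inv, abs_of_pos hc, Measure.restrict_smul]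

/-- Rescaling a parameter of `X` yields a parameter of `cX`. -/
theorem IsParameter.smul {X : Type*} [MeasurableSpace X] {μ : Measure X} {m : ℝ} {φ : ℝ → X}
    (h : IsParameter μ m φ) {c : ℝ} (hc : 0 < c) :
    IsParameter (ENNReal.ofReal c • μ) (c * m) (fun t => φ (c⁻¹ * t)) := by
  refine ⟨h.1.comp (measurable_const_mul _), ?_⟩
  rw [← Function.comp_def φ (fun t => c⁻¹ * t), ← Measure.map_map h.1 (measurable_const_mul _),
    map_inv_mul_lebIcc hc, Measure.map_smul, h.2]

theorem isParameter_smul_iff {X : Type*} [MeasurableSpace X] {μ : Measure X} {m : ℝ} {φ : ℝ → X}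
    {c : ℝ} (hc : 0 < c) :
    IsParameter (ENNReal.ofReal c • μ) (c * m) φ ↔ IsParameter μ m (fun t => φ (c * t)) := by
  constructor
  · intro h
    have h' := h.smul (inv_pos.2 hc)
    rwa [smul_smul, ← ENNReal.ofReal_mul (inv_pos.2 hc).le, inv_mul_cancel₀ hc.ne',
      ENNReal.ofReal_one, one_smul, inv_mul_cancel_left₀ hc.ne', inv_inv] at h'
  · intro h
    simpa only [mul_inv_cancel_left₀ hc.ne'] using h.smul hc

theorem boxDist_comp_equiv {α β : Type*} [MeasurableSpace α] [MeasurableSpace β]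
    (μ : Measure α) (e : α ≃ᵐ β) (lam : ℝ) (d₁ d₂ : β → β → ℝ) :
    boxDist μ lam (fun x y => d₁ (e x) (e y)) (fun x y => d₂ (e x) (e y)) =
      boxDist (μ.map e) lam d₁ d₂ := by
  unfold boxDist
  congr 1
  ext ε
  refine and_congr_right fun _ => ⟨?_, ?_⟩
  · rintro ⟨T, hT, hμ, hd⟩
    refine ⟨e.symm ⁻¹' T, e.symm.measurable hT, ?_, fun x hx y hy => ?_⟩
    · simpa [e.map_apply, ← preimage_comp] using hμ
    · simpa using hd _ hx _ hy
  · rintro ⟨T, hT, hμ, hd⟩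
    exact ⟨e ⁻¹' T, e.measurable hT, by simpa [e.map_apply] using hμ,
      fun x hx y hy => hd _ hx _ hy⟩

theorem boxDist_smul {α : Type*} [MeasurableSpace α] (μ : Measure α) {c : ℝ} (hc : 0 < c)
    (lam : ℝ) (d₁ d₂ : α → α → ℝ) :
    boxDist (ENNReal.ofReal c • μ) lam d₁ d₂ = boxDist μ (lam / c) d₁ d₂ := by
  have key : ∀ a b ε : ℝ, c * a - lam * ε ≤ c * b ↔ a - lam / c * ε ≤ b := by
    intro a b ε
    rw [← mul_le_mul_iff_right₀ hc (b := a - lam / c * ε)]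
    field_simp
  simp only [boxDist, Measure.smul_apply, smul_eq_mul, ENNReal.toReal_mul,
    ENNReal.toReal_ofReal hc.le, key]

theorem boxDist_nonneg {α : Type*} [MeasurableSpace α] (μ : Measure α) (lam : ℝ)
    (d₁ d₂ : α → α → ℝ) : 0 ≤ boxDist μ lam d₁ d₂ :=
  Real.sInf_nonneg fun _ h => h.1.le

/-- Comparison of infima of sets of nonnegative reals under division by `c`, valid also for empty
sets. -/
theorem mul_sInf_le_sInf_of_div_mem {S T : Set ℝ} {c : ℝ} (hc : 0 < c) (hS : ∀ x ∈ S, 0 ≤ x)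
    (hTS : ∀ x ∈ T, x / c ∈ S) (hne : S.Nonempty → T.Nonempty) : c * sInf S ≤ sInf T := by
  rcases T.eq_empty_or_nonempty with rfl | hT
  · have : S = ∅ := not_nonempty_iff_eq_empty.1 fun h => not_nonempty_empty (hne h)
    simp [this]
  · refine le_csInf hT fun x hx => ?_
    have := csInf_le ⟨0, hS⟩ (hTS x hx)
    rwa [le_div_iff₀' hc] at this

theorem boxDist_div_bounds {α : Type*} [MeasurableSpace α] (μ : Measure α) {lam c : ℝ}
    (hlam : 0 ≤ lam) (hc0 : 0 < c) (hc1 : c ≤ 1) (d₁ d₂ : α → α → ℝ) :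
    c * boxDist μ lam d₁ d₂ ≤ boxDist μ (lam / c) d₁ d₂ ∧
      boxDist μ (lam / c) d₁ d₂ ≤ boxDist μ lam d₁ d₂ := by
  set A : ℝ → Set ℝ := fun l => {ε : ℝ | 0 < ε ∧ ∃ T : Set α, MeasurableSet T ∧
    (μ univ).toReal - l * ε ≤ (μ T).toReal ∧ ∀ x ∈ T, ∀ y ∈ T, |d₁ x y - d₂ x y| ≤ ε}
  have hsub : A lam ⊆ A (lam / c) := by
    rintro ε ⟨hε, T, hT, hμ, hd⟩
    refine ⟨hε, T, hT, le_trans ?_ hμ, hd⟩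
    have := mul_le_mul_of_nonneg_right (le_div_self hlam hc0 hc1) hε.le
    linarith
  have hdiv : ∀ ε ∈ A (lam / c), ε / c ∈ A lam := by
    rintro ε ⟨hε, T, hT, hμ, hd⟩
    refine ⟨div_pos hε hc0, T, hT, ?_, fun x hx y hy =>
      (hd x hx y hy).trans (le_div_self hε.le hc0 hc1)⟩
    rwa [mul_div_assoc', ← div_mul_eq_mul_div]
  refine ⟨mul_sInf_le_sInf_of_div_mem hc0 (fun _ h => h.1.le) hdiv fun h => h.mono hsub, ?_⟩
  have := mul_sInf_le_sInf_of_div_mem (S := A (lam / c)) (T := A lam) one_pos (fun _ h => h.1.le)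
    (fun x hx => by simpa using hsub hx) fun ⟨x, hx⟩ => ⟨_, hdiv x hx⟩
  rwa [one_mul] at this

theorem boxDist_lebIcc_mul {c : ℝ} (hc : 0 < c) (m lam : ℝ) (d₁ d₂ : ℝ → ℝ → ℝ) :
    boxDist (lebIcc (c * m)) lam (fun s t => d₁ (c⁻¹ * s) (c⁻¹ * t))
        (fun s t => d₂ (c⁻¹ * s) (c⁻¹ * t)) =
      boxDist (lebIcc m) (lam / c) d₁ d₂ := by
  have h := boxDist_comp_equiv (lebIcc (c * m))
    (MeasurableEquiv.mulLeft₀ c⁻¹ (inv_pos.2 hc).ne') lam d₁ d₂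
  simp only [MeasurableEquiv.coe_mulLeft₀] at h
  rw [h, map_inv_mul_lebIcc hc, boxDist_smul _ hc]

/-- Scaling the masses by `c` amounts to replacing `λ` by `λ / c`. -/
theorem boxInf_smul {X Y : Type*} [PseudoMetricSpace X] [MeasurableSpace X]
    [PseudoMetricSpace Y] [MeasurableSpace Y] {c : ℝ} (hc : 0 < c) (lam m : ℝ)
    (μX : Measure X) (μY : Measure Y) :
    boxInf lam (c * m) (ENNReal.ofReal c • μX) (ENNReal.ofReal c • μY) =
      boxInf (lam / c) m μX μY := by
  unfold boxInf
  congr 1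
  ext r
  constructor
  · rintro ⟨φ, ψ, hφ, hψ, rfl⟩
    refine ⟨_, _, (isParameter_smul_iff hc).1 hφ, (isParameter_smul_iff hc).1 hψ, ?_⟩
    rw [← boxDist_lebIcc_mul hc]
    simp only [pb, mul_inv_cancel_left₀ hc.ne']
    rfl
  · rintro ⟨φ, ψ, hφ, hψ, rfl⟩
    exact ⟨_, _, hφ.smul hc, hψ.smul hc, (boxDist_lebIcc_mul hc m lam (pb φ) (pb ψ)).symm⟩

theorem boxInf_div_bounds {X Y : Type*} [PseudoMetricSpace X] [MeasurableSpace X]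
    [PseudoMetricSpace Y] [MeasurableSpace Y] {lam c : ℝ} (hlam : 0 ≤ lam) (hc0 : 0 < c)
    (hc1 : c ≤ 1) (m : ℝ) (μX : Measure X) (μY : Measure Y) :
    c * boxInf lam m μX μY ≤ boxInf (lam / c) m μX μY ∧
      boxInf (lam / c) m μX μY ≤ boxInf lam m μX μY := by
  have hbdd : ∀ l : ℝ, BddBelow {r : ℝ | ∃ (φX : ℝ → X) (φY : ℝ → Y), IsParameter μX m φX ∧
      IsParameter μY m φY ∧ r = boxDist (lebIcc m) l (pb φX) (pb φY)} := by
    intro l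
    refine ⟨0, ?_⟩
    rintro _ ⟨φ, ψ, -, -, rfl⟩
    exact boxDist_nonneg _ _ _ _
  by_cases h : ∃ (φX : ℝ → X) (φY : ℝ → Y), IsParameter μX m φX ∧ IsParameter μY m φY
  · obtain ⟨φ₀, ψ₀, hφ₀, hψ₀⟩ := h
    constructor
    · refine le_csInf ⟨_, φ₀, ψ₀, hφ₀, hψ₀, rfl⟩ ?_
      rintro _ ⟨φ, ψ, hφ, hψ, rfl⟩
      exact (mul_le_mul_of_nonneg_left (csInf_le (hbdd lam) ⟨φ, ψ, hφ, hψ, rfl⟩) hc0.le).trans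
        (boxDist_div_bounds _ hlam hc0 hc1 _ _).1
    · refine le_csInf ⟨_, φ₀, ψ₀, hφ₀, hψ₀, rfl⟩ ?_
      rintro _ ⟨φ, ψ, hφ, hψ, rfl⟩
      exact (csInf_le (hbdd _) ⟨φ, ψ, hφ, hψ, rfl⟩).trans
        (boxDist_div_bounds _ hlam hc0 hc1 _ _).2
  · have hzero : ∀ l : ℝ, boxInf l m μX μY = 0 := by
      intro l
      have : {r : ℝ | ∃ (φX : ℝ → X) (φY : ℝ → Y), IsParameter μX m φX ∧
          IsParameter μY m φY ∧ r = boxDist (lebIcc m) l (pb φX) (pb φY)} = ∅ :=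
        eq_empty_of_forall_notMem fun _ ⟨φ, ψ, hφ, hψ, _⟩ => h ⟨φ, ψ, hφ, hψ⟩
      rw [boxInf, this, Real.sInf_empty]
    simp [hzero]

/-- scaling of the box distance. -/
theorem box_scaling {X Y : Type*}
    [MetricSpace X] [CompleteSpace X] [TopologicalSpace.SeparableSpace X]
    [MeasurableSpace X] [BorelSpace X]
    [MetricSpace Y] [CompleteSpace Y] [TopologicalSpace.SeparableSpace Y]
    [MeasurableSpace Y] [BorelSpace Y]
    (μX : Measure X) (μY : Measure Y) [IsFiniteMeasure μX] [IsFiniteMeasure μY]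
    (lam : ℝ) (hlam : 0 ≤ lam) (hm : μX univ = μY univ)
    (α : ℝ) (hα0 : 0 < α) (hα1 : α ≤ 1) :
    α * mmBox lam μX μY ≤
        mmBox lam ((ENNReal.ofReal α) • μX) ((ENNReal.ofReal α) • μY) ∧
      mmBox lam ((ENNReal.ofReal α) • μX) ((ENNReal.ofReal α) • μY) ≤ mmBox lam μX μY := by
  have hmass : ((ENNReal.ofReal α • μX) univ).toReal = α * (μX univ).toReal := by
    simp [ENNReal.toReal_ofReal hα0.le]
  have hmass' : ((ENNReal.ofReal α • μX) univ).toReal =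
      ((ENNReal.ofReal α • μY) univ).toReal := by
    simp [hm]
  rw [mmBox, mmBox, if_pos (congrArg ENNReal.toReal hm), if_pos hmass', hmass, boxInf_smul hα0]
  exact boxInf_div_bounds hlam hα0 hα1 _ μX μY
end

section
/- Let X be an mm-space with m := μ_X(X) and let φ_X : [0,m] → X and ψ_X : [0,m] → X be two parameters of X. Then for any ε > 0 there exist Borel measurable maps Φ_1, Φ_2 : [0,m] → [0,m] with (Φ_1)_*(𝓛) = 𝓛 and (Φ_2)_*(𝓛) = 𝓛 such that □_0((φ_X ∘ Φ_1)*d_X, (ψ_X ∘ Φ_2)*d_X) < ε. -/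
open MeasureTheory Set Filter Topology

/-- A separable metric space is a disjoint countable union of measurable sets of diameter at
most `δ`. -/
lemma exists_measurable_partition_dist_le (X : Type*) [MetricSpace X]
    [TopologicalSpace.SeparableSpace X] [Nonempty X] [MeasurableSpace X] [BorelSpace X]
    {δ : ℝ} (hδ : 0 < δ) :
    ∃ A : ℕ → Set X, (∀ i, MeasurableSet (A i)) ∧ Pairwise (Function.onFun Disjoint A) ∧
      ⋃ i, A i = univ ∧ ∀ i, ∀ x ∈ A i, ∀ y ∈ A i, dist x y ≤ δ := by
  let B : ℕ → Set X := fun n => Metric.ball (TopologicalSpace.denseSeq X n) (δ / 2)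
  refine ⟨disjointed B, .disjointed fun _ => measurableSet_ball, disjoint_disjointed B, ?_, ?_⟩
  · rw [iUnion_disjointed, eq_univ_iff_forall]
    intro x
    obtain ⟨n, hn⟩ := (TopologicalSpace.denseRange_denseSeq X).exists_dist_lt x (half_pos hδ)
    exact mem_iUnion.2 ⟨n, hn⟩
  · intro i x hx y hy
    have hx' : dist x _ < δ / 2 := disjointed_subset B i hx
    have hy' : dist y _ < δ / 2 := disjointed_subset B i hy
    linarith [dist_triangle_right x y (TopologicalSpace.denseSeq X i)]

/-- A finite measure is the sum of its restrictions to the fibres of a countable measurable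
partition. -/
lemma sum_restrict_preimage_partition {α X : Type*} [MeasurableSpace α] [MeasurableSpace X]
    (μ : Measure α) {f : α → X} (hf : Measurable f) {A : ℕ → Set X}
    (hA : ∀ i, MeasurableSet (A i)) (hd : Pairwise (Function.onFun Disjoint A))
    (hU : ⋃ i, A i = univ) :
    Measure.sum (fun i => μ.restrict (f ⁻¹' A i)) = μ := by
  rw [← Measure.restrict_iUnion (fun i j hij => (hd hij).preimage f) fun i => hf (hA i),
    ← preimage_iUnion, hU, preimage_univ, Measure.restrict_univ]

/-- Two finite measures whose images in a separable metric space agree admit a coupling under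
which the two images are almost surely `δ`-close. -/
lemma exists_coupling_dist_le {α β X : Type*} [MeasurableSpace α] [MeasurableSpace β]
    [MetricSpace X] [TopologicalSpace.SeparableSpace X] [Nonempty X] [MeasurableSpace X]
    [BorelSpace X] (μ : Measure α) (ν : Measure β) [IsFiniteMeasure μ] [IsFiniteMeasure ν]
    {f : α → X} {g : β → X} (hf : Measurable f) (hg : Measurable g)
    (h : μ.map f = ν.map g) {δ : ℝ} (hδ : 0 < δ) :
    ∃ π : Measure (α × β), π.map Prod.fst = μ ∧ π.map Prod.snd = ν ∧
      ∀ᵐ p ∂π, dist (f p.1) (g p.2) ≤ δ := by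
  obtain ⟨A, hA, hd, hU, hdist⟩ := exists_measurable_partition_dist_le X hδ
  have hμν : ∀ i, μ (f ⁻¹' A i) = ν (g ⁻¹' A i) := fun i => by
    rw [← Measure.map_apply hf (hA i), h, Measure.map_apply hg (hA i)]
  refine ⟨Measure.sum fun i => (μ (f ⁻¹' A i))⁻¹ •
    (μ.restrict (f ⁻¹' A i)).prod (ν.restrict (g ⁻¹' A i)), ?_, ?_, ?_⟩
  · rw [Measure.map_sum measurable_fst.aemeasurable]
    conv_rhs => rw [← sum_restrict_preimage_partition μ hf hA hd hU]
    congr 1 with i : 1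
    rw [Measure.map_smul, Measure.map_fst_prod, Measure.restrict_apply_univ, ← hμν, smul_smul]
    rcases eq_or_ne (μ (f ⁻¹' A i)) 0 with h0 | h0
    · simp [Measure.restrict_eq_zero.2 h0]
    · rw [ENNReal.inv_mul_cancel h0 (measure_ne_top _ _), one_smul]
  · rw [Measure.map_sum measurable_snd.aemeasurable]
    conv_rhs => rw [← sum_restrict_preimage_partition ν hg hA hd hU]
    congr 1 with i : 1
    rw [Measure.map_smul, Measure.map_snd_prod, Measure.restrict_apply_univ, hμν, smul_smul]
    rcases eq_or_ne (ν (g ⁻¹' A i)) 0 with h0 | h0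
    · simp [Measure.restrict_eq_zero.2 h0]
    · rw [ENNReal.inv_mul_cancel h0 (measure_ne_top _ _), one_smul]
  · rw [Measure.ae_sum_iff]
    intro i
    refine Measure.ae_smul_measure ?_ _
    rw [Measure.prod_restrict]
    filter_upwards [ae_restrict_mem ((hf (hA i)).prod (hg (hA i)))] with p hp
    exact hdist i _ hp.1 _ hp.2

lemma lebIcc_eq_smul_map {m : ℝ} (hm : 0 < m) :
    lebIcc m = ENNReal.ofReal m •
      Measure.map (fun u : unitInterval => m * (u : ℝ)) volume := by
  have hpre : (fun x : ℝ => m * x) ⁻¹' Icc 0 m = unitInterval := by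
    ext x
    simp [unitInterval, mul_nonneg_iff_of_pos_left hm, mul_le_iff_le_one_right hm]
  have hcomp : (fun u : unitInterval => m * (u : ℝ)) = (fun x : ℝ => m * x) ∘ Subtype.val := rfl
  rw [lebIcc, ← Real.smul_map_volume_mul_left hm.ne', Measure.restrict_smul,
    Measure.restrict_map (measurable_const_mul m) measurableSet_Icc, hpre, abs_of_pos hm, hcomp,
    ← Measure.map_map (measurable_const_mul m) measurable_subtype_coe,
    unitInterval.measurePreserving_coe.map_eq]

/-- Every measure of total mass `m` on a nonempty standard Borel space is the image of Lebesgue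
measure on `[0, m]`. -/
lemma exists_isParameter {Y : Type*} [Nonempty Y] [MeasurableSpace Y] [StandardBorelSpace Y]
    (π : Measure Y) {m : ℝ} (hπ : π univ = ENNReal.ofReal m) :
    ∃ F : ℝ → Y, IsParameter π m F := by
  rcases le_or_gt m 0 with hm | hm
  · have hπ0 : π = 0 := by simpa [ENNReal.ofReal_eq_zero.2 hm] using hπ
    have hleb : lebIcc m = 0 := by simp [lebIcc, hm]
    exact ⟨fun _ => Classical.arbitrary Y, measurable_const, by simp [hπ0, hleb]⟩
  · have hm0 : ENNReal.ofReal m ≠ 0 := by simpa using hm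
    have : IsProbabilityMeasure ((ENNReal.ofReal m)⁻¹ • π) :=
      ⟨by simp [hπ, ENNReal.inv_mul_cancel hm0]⟩
    obtain ⟨f, hf, hmap⟩ := ((ENNReal.ofReal m)⁻¹ • π).exists_measurable_map_eq
    have hproj : Measurable fun x : ℝ => projIcc (0 : ℝ) 1 zero_le_one (x / m) :=
      continuous_projIcc.measurable.comp (measurable_id.div_const m)
    refine ⟨f ∘ fun x => projIcc 0 1 zero_le_one (x / m), hf.comp hproj, ?_⟩
    rw [lebIcc_eq_smul_map hm, Measure.map_smul, Measure.map_map (hf.comp hproj)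
      (measurable_subtype_coe.const_mul m)]
    have hid : (f ∘ fun x => projIcc (0 : ℝ) 1 zero_le_one (x / m)) ∘
        (fun u : unitInterval => m * (u : ℝ)) = f := by
      ext1 u
      simp [mul_div_cancel_left₀ _ hm.ne']
    rw [hid, hmap, smul_smul, ENNReal.mul_inv_cancel hm0 ENNReal.ofReal_ne_top, one_smul]

/-- If two maps are almost everywhere `δ`-close, the pulled back distances are within `2 * δ`
in `□_0`. -/
lemma boxDist_zero_pb_le {X : Type*} [MetricSpace X] [SecondCountableTopology X]
    [MeasurableSpace X] [BorelSpace X] {μ : Measure ℝ} {f g : ℝ → X}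
    (hf : Measurable f) (hg : Measurable g) {δ : ℝ} (hδ : 0 < δ)
    (h : ∀ᵐ s ∂μ, dist (f s) (g s) ≤ δ) : boxDist μ 0 (pb f) (pb g) ≤ 2 * δ := by
  refine csInf_le ⟨0, fun r hr => hr.1.le⟩ ⟨by positivity, {s | dist (f s) (g s) ≤ δ},
    measurableSet_le (hf.dist hg) measurable_const, ?_, fun x hx y hy => ?_⟩
  · have huniv : μ {s | dist (f s) (g s) ≤ δ} = μ univ :=
      measure_congr (eventuallyEq_univ.2 h)
    simp [huniv]
  · have hxy := dist_dist_dist_le (f x) (f y) (g x) (g y)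
    rw [Real.dist_eq] at hxy
    simp only [mem_ofPred_eq] at hx hy
    simp only [pb]
    linarith

/-- any two parameters of an mm-space can be made `□_0`-close by
precomposing with Lebesgue-measure preserving Borel maps. -/
theorem parameters_box_close {X : Type*}
    [MetricSpace X] [CompleteSpace X] [TopologicalSpace.SeparableSpace X]
    [MeasurableSpace X] [BorelSpace X]
    (μX : Measure X) [IsFiniteMeasure μX] (m : ℝ) (hm : (μX univ).toReal = m)
    (φX ψX : ℝ → X) (hφ : IsParameter μX m φX) (hψ : IsParameter μX m ψX)
    (ε : ℝ) (hε : 0 < ε) :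
    ∃ Φ₁ Φ₂ : ℝ → ℝ, Measurable Φ₁ ∧ Measurable Φ₂ ∧
      Measure.map Φ₁ (lebIcc m) = lebIcc m ∧ Measure.map Φ₂ (lebIcc m) = lebIcc m ∧
      boxDist (lebIcc m) 0 (pb (φX ∘ Φ₁)) (pb (ψX ∘ Φ₂)) < ε := by
  have hX : Nonempty X := ⟨φX 0⟩
  have : SecondCountableTopology X := UniformSpace.secondCountable_of_separable X
  have : IsFiniteMeasure (lebIcc m) := by unfold lebIcc; infer_instance
  obtain ⟨π, hfst, hsnd, hπ⟩ := exists_coupling_dist_le (lebIcc m) (lebIcc m) hφ.1 hψ.1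
    (hφ.2.trans hψ.2.symm) (δ := ε / 4) (by positivity)
  have hmass : π univ = ENNReal.ofReal m := by
    rw [← preimage_univ (f := Prod.fst), ← Measure.map_apply measurable_fst .univ, hfst]
    simp [lebIcc]
  obtain ⟨F, hF, hFπ⟩ := exists_isParameter π hmass
  refine ⟨fun s => (F s).1, fun s => (F s).2, hF.fst, hF.snd, ?_, ?_, ?_⟩
  · exact (Measure.map_map measurable_fst hF).symm.trans (hFπ ▸ hfst)
  · exact (Measure.map_map measurable_snd hF).symm.trans (hFπ ▸ hsnd)
  · have hclose : ∀ᵐ s ∂lebIcc m, dist (φX (F s).1) (ψX (F s).2) ≤ ε / 4 := by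
      rw [← hFπ] at hπ
      exact ae_of_ae_map hF.aemeasurable hπ
    calc _ ≤ 2 * (ε / 4) := boxDist_zero_pb_le (hφ.1.comp hF.fst) (hψ.1.comp hF.snd)
          (by positivity) hclose
      _ < ε := by linarith
end

section
/- (mm-Reconstruction theorem) Let X and X' be mm-spaces such that μ̲_r^X = μ̲_r^{X'} for all r ∈ ℕ. Then X and X' are isomorphic, i.e., there exists a measure preserving isometry between the supports of μ_X and μ_{X'}. -/
open MeasureTheory Set Filter Topology

open scoped NNReal ENNReal

lemma exists_isCompact_subset_lt_measure_of_mem_ae {α : Type*} [TopologicalSpace α]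
    [PolishSpace α] [MeasurableSpace α] [BorelSpace α] {P : Measure α} [IsProbabilityMeasure P]
    {A : Set α} (hA : A ∈ ae P) : ∃ K ⊆ A, IsCompact K ∧ 2⁻¹ < P K := by
  obtain ⟨D, hDA, hD, hD0⟩ := exists_measurable_superset_of_null (mem_ae_iff.mp hA)
  have h1 : P Dᶜ = 1 := (prob_compl_eq_one_iff hD).2 hD0
  obtain ⟨K, hK, hKc, hKP⟩ :=
    innerRegular_isCompact_isClosed_measurableSet_of_finite P hD.compl 2⁻¹
      (by rw [h1]; exact ENNReal.one_half_lt_one)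
  exact ⟨K, hK.trans (compl_subset_comm.mp hDA), hKc.1, hKP⟩

/-- If two continuous maps push two probability measures on Polish spaces forward to the same
measure, then any two conull sets contain points with a common image. -/
lemma exists_mem_mem_eq_of_map_eq {α β γ : Type*}
    [TopologicalSpace α] [PolishSpace α] [MeasurableSpace α] [BorelSpace α]
    [TopologicalSpace β] [PolishSpace β] [MeasurableSpace β] [BorelSpace β]
    [TopologicalSpace γ] [T2Space γ] [MeasurableSpace γ] [BorelSpace γ]
    {P : Measure α} {Q : Measure β} [IsProbabilityMeasure P] [IsProbabilityMeasure Q]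
    {f : α → γ} {g : β → γ} (hf : Continuous f) (hg : Continuous g)
    (h : P.map f = Q.map g) {A : Set α} {B : Set β} (hA : A ∈ ae P) (hB : B ∈ ae Q) :
    ∃ a ∈ A, ∃ b ∈ B, f a = g b := by
  obtain ⟨K, hKA, hK, hKP⟩ := exists_isCompact_subset_lt_measure_of_mem_ae hA
  obtain ⟨L, hLB, hL, hLQ⟩ := exists_isCompact_subset_lt_measure_of_mem_ae hB
  by_contra! hne
  have hdisj : Disjoint (f '' K) (g '' L) := by
    rw [Set.disjoint_left]
    rintro _ ⟨a, ha, rfl⟩ ⟨b, hb, hab⟩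
    exact hne a (hKA ha) b (hLB hb) hab.symm
  have hgL : MeasurableSet (g '' L) := (hL.image hg).measurableSet
  have : IsProbabilityMeasure (P.map f) := Measure.isProbabilityMeasure_map (by fun_prop)
  have h1 : P K ≤ P.map f (f '' K) :=
    (measure_mono (subset_preimage_image f K)).trans
      (Measure.le_map_apply hf.aemeasurable _)
  have h2 : Q L ≤ P.map f (g '' L) := by
    rw [h]
    exact (measure_mono (subset_preimage_image g L)).trans
      (Measure.le_map_apply hg.aemeasurable _)
  have h3 : P.map f (f '' K) + P.map f (g '' L) ≤ 1 := by
    rw [← measure_union hdisj hgL]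
    exact prob_le_one
  refine absurd (h3.trans_lt' (ENNReal.add_lt_add (hKP.trans_le h1) (hLQ.trans_le h2))) ?_
  simp [ENNReal.inv_two_add_inv_two]

/-- The uniform probability measure on the first `n + 1` terms of a sequence. -/
noncomputable def empiricalMeasure {X : Type*} [MeasurableSpace X] (x : ℕ → X) (n : ℕ) : ProbabilityMeasure X :=
  ⟨(ProbabilityTheory.uniformOn (Finset.range (n + 1) : Set ℕ)).map x,
    have := ProbabilityTheory.isProbabilityMeasure_uniformOn
      (Finset.finite_toSet (Finset.range (n + 1))) ⟨0, by simp⟩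
    Measure.isProbabilityMeasure_map (measurable_of_countable x).aemeasurable⟩

lemma empiricalMeasure_apply {X : Type*} [MeasurableSpace X] (x : ℕ → X) (n : ℕ) {s : Set X}
    (hs : MeasurableSet s) :
    ((empiricalMeasure x n s : ℝ≥0) : ℝ)
      = (∑ i ∈ Finset.range (n + 1), s.indicator (fun _ => (1 : ℝ)) (x i)) / ((n + 1 : ℕ) : ℝ) := by
  classical
  have hfilter : (Finset.range (n + 1) : Set ℕ) ∩ x ⁻¹' s
      = ((Finset.range (n + 1)).filter fun i => x i ∈ s : Finset ℕ) := by
    ext i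
    simp
  change ((ProbabilityTheory.uniformOn (Finset.range (n + 1) : Set ℕ)).map x s).toReal = _
  rw [Measure.map_apply (measurable_of_countable x) hs,
    ← ProbabilityTheory.uniformOn_inter_self (Finset.finite_toSet _), hfilter,
    ProbabilityTheory.uniformOn_apply_finset,
    Finset.inter_eq_right.2 (Finset.filter_subset _ _)]
  rw [ENNReal.toReal_div, ENNReal.toReal_natCast, ENNReal.toReal_natCast]
  simp [Set.indicator_apply]

lemma map_empiricalMeasure {X Y : Type*} [MeasurableSpace X] [MeasurableSpace Y] (x : ℕ → X)
    {e : X → Y} (he : Measurable e) (n : ℕ) :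
    (empiricalMeasure x n).map he.aemeasurable = empiricalMeasure (e ∘ x) n := by
  apply Subtype.ext
  exact Measure.map_map he (measurable_of_countable x)

/-- Varadarajan's theorem: almost surely, the empirical measures of an i.i.d. sequence converge
weakly to its law. -/
lemma ae_tendsto_empiricalMeasure {X : Type*} [TopologicalSpace X] [SecondCountableTopology X]
    [MeasurableSpace X] [OpensMeasurableSpace X] (μ : ProbabilityMeasure X) :
    ∀ᵐ x ∂Measure.infinitePi (fun _ : ℕ => (μ : Measure X)),
      Tendsto (empiricalMeasure x) atTop (𝓝 μ) := by
  obtain ⟨b, hbc, -, hb⟩ := TopologicalSpace.exists_countable_basis X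
  let S : Set (Set X) := sInter '' {T | T.Finite ∧ T ⊆ b}
  have hSc : S.Countable := (countable_ofPred_finite_subset hbc).image _
  have hSo : ∀ s ∈ S, IsOpen s := by
    rintro _ ⟨T, ⟨hT, hTb⟩, rfl⟩
    exact hT.isOpen_sInter fun t ht => hb.isOpen (hTb ht)
  have hSpi : IsPiSystem S := by
    rintro _ ⟨T, ⟨hT, hTb⟩, rfl⟩ _ ⟨U, ⟨hU, hUb⟩, rfl⟩ -
    exact ⟨T ∪ U, ⟨hT.union hU, union_subset hTb hUb⟩, sInter_union T U⟩
  have key : ∀ s ∈ S, ∀ᵐ x ∂Measure.infinitePi (fun _ : ℕ => (μ : Measure X)),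
      Tendsto (fun n => empiricalMeasure x n s) atTop (𝓝 (μ s)) := by
    intro s hs
    have hsm := (hSo s hs).measurableSet
    have hm : Measurable (s.indicator fun _ => (1 : ℝ)) := measurable_const.indicator hsm
    have hident (i : ℕ) : ProbabilityTheory.IdentDistrib
        (fun x : ℕ → X => s.indicator (fun _ => (1 : ℝ)) (x i))
        (fun x : ℕ → X => s.indicator (fun _ => (1 : ℝ)) (x 0))
        (Measure.infinitePi (fun _ : ℕ => (μ : Measure X)))
        (Measure.infinitePi (fun _ : ℕ => (μ : Measure X))) := by
      refine ProbabilityTheory.IdentDistrib.comp (f := fun x : ℕ → X => x i)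
        (g := fun x : ℕ → X => x 0) ⟨(measurable_pi_apply i).aemeasurable,
          (measurable_pi_apply 0).aemeasurable, ?_⟩ hm
      exact (Measure.infinitePi_map_eval _ i).trans (Measure.infinitePi_map_eval (fun _ : ℕ => (μ : Measure X)) 0).symm
    have hslln := ProbabilityTheory.strong_law_ae_real
      (fun i (x : ℕ → X) => s.indicator (fun _ => (1 : ℝ)) (x i))
      (μ := Measure.infinitePi (fun _ : ℕ => (μ : Measure X)))
      (Integrable.of_bound (C := 1) (hm.comp (measurable_pi_apply 0)).aestronglyMeasurable
        (.of_forall fun x => by by_cases h : x 0 ∈ s <;> simp [h]))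
      (fun i j hij => (ProbabilityTheory.iIndepFun_infinitePi
        (P := fun _ : ℕ => (μ : Measure X)) (X := fun _ => s.indicator fun _ => (1 : ℝ))
        (fun _ => hm)).indepFun hij) hident
    have hint : ∫ x : ℕ → X, s.indicator (fun _ => (1 : ℝ)) (x 0)
        ∂(Measure.infinitePi (fun _ : ℕ => (μ : Measure X))) = μ s := by
      rw [← integral_map (φ := fun x : ℕ → X => x 0) (f := s.indicator fun _ => (1 : ℝ))
        (measurable_pi_apply 0).aemeasurable hm.aestronglyMeasurable, Measure.infinitePi_map_eval,
        integral_indicator_const _ hsm]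
      simp [Measure.real]
      rfl
    filter_upwards [hslln] with x hx
    rw [← NNReal.tendsto_coe]
    rw [hint] at hx
    simpa only [empiricalMeasure_apply _ _ hsm, Function.comp_def] using hx.comp (tendsto_add_atTop_nat 1)
  filter_upwards [(ae_ball_iff hSc).2 key] with x hx
  refine hSpi.tendsto_probabilityMeasure_of_tendsto_of_mem
    (fun s hs => (hSo s hs).measurableSet) (fun u hu y hy => ?_) hx
  obtain ⟨t, ht, hyt, htu⟩ := hb.exists_subset_of_mem_open hy hu
  exact ⟨t, ⟨{t}, ⟨finite_singleton t, by simpa using ht⟩, sInter_singleton t⟩,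
    (hb.isOpen ht).mem_nhds hyt, htu⟩

/-- A sequence whose empirical measures converge to a measure of full support is dense. -/
lemma denseRange_of_tendsto_empiricalMeasure {X : Type*} [PseudoEMetricSpace X]
    [MeasurableSpace X] [OpensMeasurableSpace X] {μ : ProbabilityMeasure X}
    [(μ : Measure X).IsOpenPosMeasure] {x : ℕ → X}
    (hx : Tendsto (empiricalMeasure x) atTop (𝓝 μ)) : DenseRange x := by
  refine dense_iff_inter_open.2 fun U hU hUne => ?_
  have hpos : 0 < (μ : Measure X) U := hU.measure_pos _ hUne
  obtain ⟨n, hn⟩ := (eventually_lt_of_lt_liminf (hpos.trans_le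
    (ProbabilityMeasure.le_liminf_measure_open_of_tendsto hx hU))).exists
  rw [empiricalMeasure, ProbabilityMeasure.coe_mk, Measure.map_apply
    (measurable_of_countable x) hU.measurableSet] at hn
  obtain ⟨i, hi⟩ := nonempty_of_measure_ne_zero hn.ne'
  exact ⟨x i, hi, mem_range_self i⟩

lemma map_restrict_map_dist_infinitePi {X : Type*} [PseudoMetricSpace X]
    [SecondCountableTopology X] [MeasurableSpace X] [BorelSpace X] (μ : Measure X)
    [IsProbabilityMeasure μ] (J : Finset (ℕ × ℕ)) (r : ℕ) (hr : ∀ p ∈ J, p.1 < r ∧ p.2 < r) :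
    ((Measure.infinitePi fun _ : ℕ => μ).map
        (fun x (p : ℕ × ℕ) => dist (x p.1) (x p.2))).map J.restrict
      = (matMeasure μ (fun a b => dist a b) r).map
        (fun M (p : J) => M ⟨p.1.1, (hr p.1 p.2).1⟩ ⟨p.1.2, (hr p.1 p.2).2⟩) := by
  rw [matMeasure, ← Measure.infinitePi_eq_pi,
    ← Measure.map_infinitePi_infinitePi_of_inj (P := fun _ : ℕ => μ) Fin.val_injective,
    Measure.map_map (by fun_prop) (by fun_prop), Measure.map_map (by fun_prop) (by fun_prop),
    Measure.map_map (by fun_prop) (by fun_prop)]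
  rfl

/-- The matrix measures of a probability measure determine the law of the infinite matrix of
mutual distances of an i.i.d. sequence. -/
lemma map_dist_infinitePi_eq {X X' : Type*}
    [PseudoMetricSpace X] [SecondCountableTopology X] [MeasurableSpace X] [BorelSpace X]
    [PseudoMetricSpace X'] [SecondCountableTopology X'] [MeasurableSpace X'] [BorelSpace X']
    {μ : Measure X} {μ' : Measure X'} [IsProbabilityMeasure μ] [IsProbabilityMeasure μ']
    (h : ∀ r : ℕ, matMeasure μ (fun a b => dist a b) r
        = matMeasure μ' (fun a b => dist a b) r) :
    (Measure.infinitePi fun _ : ℕ => μ).map (fun x (p : ℕ × ℕ) => dist (x p.1) (x p.2))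
      = (Measure.infinitePi fun _ : ℕ => μ').map (fun x (p : ℕ × ℕ) => dist (x p.1) (x p.2)) := by
  refine IsProjectiveLimit.unique (P := fun J => ((Measure.infinitePi fun _ : ℕ => μ).map
    (fun x (p : ℕ × ℕ) => dist (x p.1) (x p.2))).map J.restrict) (fun J => rfl) fun J => ?_
  have hr : ∀ p ∈ J, p.1 < J.sup (fun p => p.1 + p.2) + 1 ∧ p.2 < J.sup (fun p => p.1 + p.2) + 1 :=
    fun p hp => by
      have : p.1 + p.2 ≤ J.sup fun p : ℕ × ℕ => p.1 + p.2 :=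
        Finset.le_sup (f := fun p : ℕ × ℕ => p.1 + p.2) hp
      omega
  beta_reduce
  rw [map_restrict_map_dist_infinitePi μ J _ hr, map_restrict_map_dist_infinitePi μ' J _ hr, h]

/-- Two dense sequences with the same mutual distances in complete metric spaces correspond to
each other under an isometry. -/
lemma exists_isometryEquiv_of_dist_eq {ι X X' : Type*} [MetricSpace X] [CompleteSpace X]
    [MetricSpace X'] [CompleteSpace X'] {x : ι → X} {x' : ι → X'} (hx : DenseRange x)
    (hx' : DenseRange x') (h : ∀ i j, dist (x i) (x j) = dist (x' i) (x' j)) :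
    ∃ e : X ≃ᵢ X', ∀ i, e (x i) = x' i := by
  let _ : PseudoMetricSpace ι := PseudoMetricSpace.induced x inferInstance
  have hux : Isometry x := Isometry.of_dist_eq fun _ _ => rfl
  have hux' : Isometry x' := Isometry.of_dist_eq fun i j => (h i j).symm
  let p : AbstractCompletion ι := ⟨X, x, inferInstance, inferInstance, inferInstance,
    hux.isUniformInducing, hx⟩
  let p' : AbstractCompletion ι := ⟨X', x', inferInstance, inferInstance, inferInstance,
    hux'.isUniformInducing, hx'⟩
  let e : X ≃ᵤ X' := p.compareEquiv p'
  have he : ∀ i, e (x i) = x' i := p.compare_coe p'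
  refine ⟨⟨e.toEquiv, Isometry.of_dist_eq fun a b => ?_⟩, he⟩
  have hec : Continuous e := e.continuous
  refine hx.induction_on₂ (p := fun a b => dist (e a) (e b) = dist a b)
    (isClosed_eq (by fun_prop) (by fun_prop)) (fun i j => ?_) a b
  rw [he, he, h]

lemma exists_isometryEquiv_of_isProbabilityMeasure {X X' : Type*}
    [MetricSpace X] [CompleteSpace X] [SecondCountableTopology X]
    [MeasurableSpace X] [BorelSpace X]
    [MetricSpace X'] [CompleteSpace X'] [SecondCountableTopology X']
    [MeasurableSpace X'] [BorelSpace X']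
    {μ : Measure X} {μ' : Measure X'} [IsProbabilityMeasure μ] [IsProbabilityMeasure μ']
    [μ.IsOpenPosMeasure] [μ'.IsOpenPosMeasure]
    (h : ∀ r : ℕ, matMeasure μ (fun a b => dist a b) r
        = matMeasure μ' (fun a b => dist a b) r) :
    ∃ e : X ≃ᵢ X', μ.map e = μ' := by
  let P : ProbabilityMeasure X := ⟨μ, inferInstance⟩
  let P' : ProbabilityMeasure X' := ⟨μ', inferInstance⟩
  obtain ⟨x, hx, x', hx', hxx'⟩ := exists_mem_mem_eq_of_map_eq (by fun_prop) (by fun_prop)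
    (map_dist_infinitePi_eq h) (ae_tendsto_empiricalMeasure P) (ae_tendsto_empiricalMeasure P')
  have : (P : Measure X).IsOpenPosMeasure := ‹μ.IsOpenPosMeasure›
  have : (P' : Measure X').IsOpenPosMeasure := ‹μ'.IsOpenPosMeasure›
  obtain ⟨e, he⟩ := exists_isometryEquiv_of_dist_eq (denseRange_of_tendsto_empiricalMeasure hx)
    (denseRange_of_tendsto_empiricalMeasure hx') fun i j => congrFun hxx' (i, j)
  have hlim := ProbabilityMeasure.tendsto_map_of_tendsto_of_continuous _ _ hx e.continuous
  simp only [map_empiricalMeasure _ e.continuous.measurable] at hlim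
  rw [show e ∘ x = x' from funext he] at hlim
  exact ⟨e, congrArg (fun m : ProbabilityMeasure X' => (m : Measure X'))
    (tendsto_nhds_unique hlim hx')⟩

lemma matMeasure_smul {α : Type*} [MeasurableSpace α] (μ : Measure α) [IsFiniteMeasure μ]
    (d : α → α → ℝ) (c : ℝ≥0) (r : ℕ) :
    matMeasure (c • μ) d r = c ^ r • matMeasure μ d r := by
  rw [matMeasure, matMeasure, ← Measure.map_smul]
  congr 1
  refine Measure.pi_eq fun s hs => ?_
  rw [Measure.smul_apply, Measure.pi_pi]
  simp only [Measure.smul_apply, ENNReal.smul_def, smul_eq_mul, Finset.prod_mul_distrib,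
    Finset.prod_const, Finset.card_univ, Fintype.card_fin, ENNReal.coe_pow]

lemma measure_univ_eq_of_matMeasure_eq {X X' : Type*}
    [PseudoMetricSpace X] [SecondCountableTopology X] [MeasurableSpace X] [BorelSpace X]
    [PseudoMetricSpace X'] [SecondCountableTopology X'] [MeasurableSpace X'] [BorelSpace X']
    {μ : Measure X} {μ' : Measure X'} [IsFiniteMeasure μ] [IsFiniteMeasure μ']
    (h : matMeasure μ (fun a b => dist a b) 1 = matMeasure μ' (fun a b => dist a b) 1) :
    μ univ = μ' univ := by
  have := congrArg (fun m => m univ) h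
  simp only [matMeasure] at this
  rw [Measure.map_apply (by fun_prop) .univ, Measure.map_apply (by fun_prop) .univ] at this
  simpa [Measure.pi_univ] using this

lemma exists_isometryEquiv_of_matMeasure_eq {X X' : Type*}
    [MetricSpace X] [CompleteSpace X] [SecondCountableTopology X]
    [MeasurableSpace X] [BorelSpace X]
    [MetricSpace X'] [CompleteSpace X'] [SecondCountableTopology X']
    [MeasurableSpace X'] [BorelSpace X']
    {μ : Measure X} {μ' : Measure X'} [IsFiniteMeasure μ] [IsFiniteMeasure μ']
    [μ.IsOpenPosMeasure] [μ'.IsOpenPosMeasure]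
    (h : ∀ r : ℕ, matMeasure μ (fun a b => dist a b) r
        = matMeasure μ' (fun a b => dist a b) r) :
    ∃ e : X ≃ᵢ X', μ.map e = μ' := by
  have huniv := measure_univ_eq_of_matMeasure_eq (h 1)
  rcases eq_or_ne (μ univ) 0 with h0 | h0
  · have : IsEmpty X := univ_eq_empty_iff.mp (isOpen_univ.measure_eq_zero_iff μ |>.mp h0)
    have : IsEmpty X' :=
      univ_eq_empty_iff.mp (isOpen_univ.measure_eq_zero_iff μ' |>.mp (huniv ▸ h0))
    exact ⟨⟨Equiv.equivOfIsEmpty X X', fun a => isEmptyElim a⟩, Subsingleton.elim _ _⟩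
  · set c : ℝ≥0 := (μ univ).toNNReal⁻¹ with hc
    have hc0 : c ≠ 0 := by
      simp [hc, ENNReal.toNNReal_eq_zero_iff, h0]
    have hc1 : (c : ℝ≥0∞) * μ univ = 1 := by
      rw [hc, ENNReal.coe_inv (by simp [ENNReal.toNNReal_eq_zero_iff, h0]),
        ENNReal.coe_toNNReal (measure_ne_top _ _),
        ENNReal.inv_mul_cancel h0 (measure_ne_top _ _)]
    have : IsProbabilityMeasure (c • μ) := ⟨hc1⟩
    have : IsProbabilityMeasure (c • μ') := ⟨by rw [huniv] at hc1; exact hc1⟩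
    have : (c • μ).IsOpenPosMeasure :=
      Measure.isOpenPosMeasure_smul μ (ENNReal.coe_ne_zero.2 hc0)
    have : (c • μ').IsOpenPosMeasure :=
      Measure.isOpenPosMeasure_smul μ' (ENNReal.coe_ne_zero.2 hc0)
    obtain ⟨e, he⟩ := exists_isometryEquiv_of_isProbabilityMeasure (μ := c • μ) (μ' := c • μ')
      fun r => by rw [matMeasure_smul, matMeasure_smul, h r]
    refine ⟨e, ?_⟩
    rw [Measure.map_smul] at he
    have := congrArg (fun m => c⁻¹ • m) he
    simpa [smul_smul, hc0] using this

lemma msupport_eq_support {X : Type*} [TopologicalSpace X] [MeasurableSpace X] (μ : Measure X) :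
    msupport μ = μ.support := by
  rw [Measure.support_eq_forall_isOpen]
  ext x
  exact forall_congr' fun U => imp.swap

lemma isClosed_msupport {X : Type*} [TopologicalSpace X] [MeasurableSpace X] (μ : Measure X) :
    IsClosed (msupport μ) :=
  msupport_eq_support μ ▸ Measure.isClosed_support

lemma map_val_comap_msupport {X : Type*} [TopologicalSpace X] [SecondCountableTopology X]
    [MeasurableSpace X] [BorelSpace X] (μ : Measure X) :
    (μ.comap (Subtype.val : msupport μ → X)).map Subtype.val = μ := by
  rw [map_comap_subtype_coe (isClosed_msupport μ).measurableSet]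
  refine Measure.restrict_eq_self_of_ae_mem ?_
  rw [msupport_eq_support]
  exact Measure.support_mem_ae

lemma isOpenPosMeasure_comap_msupport {X : Type*} [TopologicalSpace X] [SecondCountableTopology X]
    [MeasurableSpace X] [BorelSpace X] (μ : Measure X) :
    (μ.comap (Subtype.val : msupport μ → X)).IsOpenPosMeasure := by
  refine ⟨?_⟩
  rintro _ ⟨U, hU, rfl⟩ ⟨x, hx⟩
  have := x.2 U hU hx
  rw [← map_val_comap_msupport μ, Measure.map_apply measurable_subtype_coe hU.measurableSet] at this
  exact this.ne'

lemma matMeasure_comap_msupport {X : Type*} [PseudoMetricSpace X] [SecondCountableTopology X]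
    [MeasurableSpace X] [BorelSpace X] (μ : Measure X) [IsFiniteMeasure μ] (r : ℕ) :
    matMeasure (μ.comap (Subtype.val : msupport μ → X)) (fun a b => dist a b) r
      = matMeasure μ (fun a b => dist a b) r := by
  conv_rhs => rw [← map_val_comap_msupport μ]
  rw [matMeasure, matMeasure, ← Measure.pi_map_pi (fun _ => by fun_prop),
    Measure.map_map (by fun_prop) (by fun_prop)]
  rfl

/-- the mm-reconstruction theorem. -/
theorem mm_reconstruction {X X' : Type*}
    [MetricSpace X] [CompleteSpace X] [TopologicalSpace.SeparableSpace X]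
    [MeasurableSpace X] [BorelSpace X]
    [MetricSpace X'] [CompleteSpace X'] [TopologicalSpace.SeparableSpace X']
    [MeasurableSpace X'] [BorelSpace X']
    (μX : Measure X) (μX' : Measure X') [IsFiniteMeasure μX] [IsFiniteMeasure μX']
    (h : ∀ r : ℕ, matMeasure μX (fun a b => dist a b) r
        = matMeasure μX' (fun a b => dist a b) r) :
    MMIsom μX μX' := by
  have := UniformSpace.secondCountable_of_separable X
  have := UniformSpace.secondCountable_of_separable X'
  have := (isClosed_msupport μX).completeSpace_coe
  have := (isClosed_msupport μX').completeSpace_coe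
  have := isOpenPosMeasure_comap_msupport μX
  have := isOpenPosMeasure_comap_msupport μX'
  obtain ⟨e, he⟩ := exists_isometryEquiv_of_matMeasure_eq
    (μ := μX.comap (Subtype.val : msupport μX → X))
    (μ' := μX'.comap (Subtype.val : msupport μX' → X'))
    fun r => by rw [matMeasure_comap_msupport, matMeasure_comap_msupport, h r]
  exact ⟨e, e.bijective, e.isometry, he⟩
end

section
/- Let (X, μ) be a measure space with μ(X) < +∞ and let λ ≥ 0. For any two semi-distance functions d and d' on X, H_λLι_1(d, d') ≤ □_λ(d, d'). -/
open MeasureTheory Set Filter Topology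

lemma IsSemiDist.nonneg {α : Type*} {d : α → α → ℝ} (hd : IsSemiDist d) (x y : α) :
    0 ≤ d x y := by
  have h := hd.triangle x y x
  rw [hd.refl, hd.symm y x] at h
  linarith

lemma IsSemiDist.apply_mem_Lip1 {α : Type*} {d : α → α → ℝ} (hd : IsSemiDist d) (x₀ : α) :
    d x₀ ∈ Lip1 d := by
  intro x y
  have h₁ := hd.triangle x₀ x y
  have h₂ := hd.triangle x₀ y x
  rw [hd.symm y x] at h₂
  exact abs_le.2 ⟨by linarith, by linarith⟩

lemma IsSemiDist.const_mem_Lip1 {α : Type*} {d : α → α → ℝ} (hd : IsSemiDist d) (c : ℝ) :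
    (fun _ => c) ∈ Lip1 d := by
  intro x y
  simpa using hd.nonneg x y

lemma IsSemiDist.min_mem_Lip1 {α : Type*} {d : α → α → ℝ} (hd : IsSemiDist d) {f : α → ℝ}
    (hf : f ∈ Lip1 d) (c : ℝ) : (fun x => min (f x) c) ∈ Lip1 d := by
  intro x y
  have h := abs_min_sub_min_le_max (f x) c (f y) c
  refine h.trans (max_le (hf x y) ?_)
  simpa using hd.nonneg x y

lemma meDist_comm {α : Type*} [MeasurableSpace α] (μ : Measure α) (lam : ℝ) (f g : α → ℝ) :
    meDist μ lam f g = meDist μ lam g f := by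
  simp only [meDist, abs_sub_comm]

lemma HL_comm {α : Type*} [MeasurableSpace α] (μ : Measure α) (lam : ℝ) (d d' : α → α → ℝ) :
    HL μ lam d d' = HL μ lam d' d := by
  unfold HL
  congr 1
  ext ε
  simp only [mem_ofPred_eq, meDist_comm μ lam]
  constructor <;> rintro ⟨h, h₁, h₂⟩ <;> refine ⟨h, fun f hf => ?_, fun f hf => ?_⟩
  · simpa only [meDist_comm μ lam] using h₂ f hf
  · simpa only [meDist_comm μ lam] using h₁ f hf
  · simpa only [meDist_comm μ lam] using h₂ f hf
  · simpa only [meDist_comm μ lam] using h₁ f hf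

lemma meDist_le {α : Type*} [MeasurableSpace α] (μ : Measure α) {lam ε : ℝ} {f g : α → ℝ}
    (hε : 0 < ε) (h : (μ {x | ε ≤ |f x - g x|}).toReal ≤ lam * ε) : meDist μ lam f g ≤ ε :=
  csInf_le ⟨0, fun _ hx => hx.1.le⟩ ⟨hε, h⟩

/-- A McShane-type extension: a function that is `1`-Lipschitz up to `ε` on `T` is
`ε / 2`-close on `T` to a `1`-Lipschitz function. -/
lemma exists_mem_Lip1_abs_sub_le {α : Type*} {d : α → α → ℝ} (hd : IsSemiDist d) {f : α → ℝ}
    {T : Set α} {ε : ℝ} (hf : ∀ x ∈ T, ∀ y ∈ T, f x - f y ≤ d x y + ε) :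
    ∃ g ∈ Lip1 d, ∀ x ∈ T, |f x - g x| ≤ ε / 2 := by
  rcases T.eq_empty_or_nonempty with rfl | ⟨y₀, hy₀⟩
  · exact ⟨_, hd.const_mem_Lip1 0, by simp⟩
  have : Nonempty T := ⟨⟨y₀, hy₀⟩⟩
  have hbdd : ∀ x, BddBelow (range fun y : T => f y + d x y) := by
    refine fun x => ⟨f y₀ - ε - d x y₀, ?_⟩
    rintro _ ⟨y, rfl⟩
    have h₁ := hf y₀ hy₀ y y.2
    have h₂ := hd.triangle y₀ x y
    rw [hd.symm y₀ x] at h₂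
    dsimp only
    linarith
  have key : ∀ x y, (⨅ z : T, f z + d x z) ≤ (⨅ z : T, f z + d y z) + d x y := by
    intro x y
    rw [← sub_le_iff_le_add]
    refine le_ciInf fun z => ?_
    have h₁ := ciInf_le (hbdd x) z
    have h₂ := hd.triangle x y z
    linarith
  refine ⟨fun x => (⨅ y : T, f y + d x y) + ε / 2, fun x y => ?_, fun x hx => ?_⟩
  · have h₁ := key x y
    have h₂ := key y x
    rw [hd.symm y x] at h₂
    exact abs_le.2 ⟨by linarith, by linarith⟩
  · have h₁ := ciInf_le (hbdd x) ⟨x, hx⟩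
    have h₂ : f x - ε ≤ ⨅ y : T, f y + d x y :=
      le_ciInf fun y => by linarith [hf x hx y y.2]
    simp only [hd.refl] at h₁
    exact abs_le.2 ⟨by linarith, by linarith⟩

lemma exists_mem_Lip1_meDist_le {α : Type*} [MeasurableSpace α] (μ : Measure α)
    [IsFiniteMeasure μ] {lam ε : ℝ} {d d' : α → α → ℝ} (hd' : IsSemiDist d') (hε : 0 < ε)
    {T : Set α} (hT : MeasurableSet T) (hμ : (μ univ).toReal - lam * ε ≤ (μ T).toReal)
    (h : ∀ x ∈ T, ∀ y ∈ T, |d x y - d' x y| ≤ ε) {f : α → ℝ} (hf : f ∈ Lip1 d) :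
    ∃ g ∈ Lip1 d', meDist μ lam f g ≤ ε := by
  obtain ⟨g, hg, hfg⟩ := exists_mem_Lip1_abs_sub_le (T := T) (ε := ε) (f := f) hd'
    fun x hx y hy => by linarith [(abs_le.1 (h x hx y hy)).2, (abs_le.1 (hf x y)).2]
  refine ⟨g, hg, meDist_le μ hε ?_⟩
  have hsub : {x | ε ≤ |f x - g x|} ⊆ Tᶜ := by
    intro x hx hxT
    have h₁ := hfg x hxT
    simp only [mem_ofPred_eq] at hx
    linarith
  have h₁ : μ.real {x | ε ≤ |f x - g x|} ≤ μ.real Tᶜ := measureReal_mono hsub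
  have h₂ := measureReal_add_measureReal_compl (μ := μ) hT
  simp only [measureReal_def] at h₁ h₂
  linarith

lemma exists_mem_notMem_of_measure_ne_zero {α : Type*} [MeasurableSpace α] {μ : Measure α}
    {A B : Set α} (hA : μ A ≠ 0) (hB : μ B = 0) : ∃ x ∈ A, x ∉ B := by
  by_contra! h
  exact hA (measure_mono_null h hB)

/-- Since `sInf ∅ = 0` in `ℝ`, the distance `me₀` vanishes on pairs of functions whose difference
is essentially unbounded. -/
lemma meDist_zero_eq_zero {α : Type*} [MeasurableSpace α] (μ : Measure α) [IsFiniteMeasure μ]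
    {f g : α → ℝ} (h : ∀ ε, μ {x | ε ≤ |f x - g x|} ≠ 0) : meDist μ 0 f g = 0 := by
  refine (congrArg sInf (eq_empty_of_forall_notMem fun ε hε => ?_)).trans Real.sInf_empty
  have h₁ : (μ {x | ε ≤ |f x - g x|}).toReal = 0 :=
    le_antisymm (by simpa using hε.2) ENNReal.toReal_nonneg
  rcases ENNReal.toReal_eq_zero_iff _ |>.1 h₁ with h₂ | h₂
  · exact h ε h₂
  · exact measure_ne_top _ _ h₂

lemma exists_mem_Lip1_meDist_zero_eq_zero {α : Type*} [MeasurableSpace α] (μ : Measure α)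
    [IsFiniteMeasure μ] {d : α → α → ℝ} (hd : IsSemiDist d) {x₀ : α}
    (h : ∀ C, μ {y | C ≤ d x₀ y} ≠ 0) (f : α → ℝ) :
    ∃ g ∈ Lip1 d, meDist μ 0 f g = 0 := by
  by_cases hf : ∃ C, μ {x | C ≤ |f x|} = 0
  · obtain ⟨C, hC⟩ := hf
    refine ⟨d x₀, hd.apply_mem_Lip1 x₀, meDist_zero_eq_zero μ fun ε hε => ?_⟩
    obtain ⟨x, hx, hx'⟩ := exists_mem_notMem_of_measure_ne_zero (h (ε + C))
      (measure_union_null hε hC)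
    simp only [mem_union, mem_ofPred_eq, not_or, not_le] at hx hx'
    have h₁ := neg_abs_le (f x - d x₀ x)
    have h₂ := le_abs_self (f x)
    linarith
  · push Not at hf
    exact ⟨_, hd.const_mem_Lip1 0, meDist_zero_eq_zero μ (by simpa using hf)⟩

/-- A semi-distance is either bounded on a conull measurable set or essentially unbounded from
every point. -/
lemma IsSemiDist.bounded_or_unbounded {α : Type*} [MeasurableSpace α] (μ : Measure α)
    {d : α → α → ℝ} (hd : IsSemiDist d) (x₀ : α) :
    (∃ C, ∃ T, MeasurableSet T ∧ μ Tᶜ = 0 ∧ ∀ x ∈ T, ∀ y ∈ T, d x y ≤ C) ∨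
      ∀ C, μ {y | C ≤ d x₀ y} ≠ 0 := by
  refine or_iff_not_imp_right.2 fun h => ?_
  push Not at h
  obtain ⟨C, hC⟩ := h
  refine ⟨2 * C, (toMeasurable μ {y | C ≤ d x₀ y})ᶜ, (measurableSet_toMeasurable _ _).compl,
    by simpa using hC, fun x hx y hy => ?_⟩
  have hx' : ¬ C ≤ d x₀ x := fun h => hx (subset_toMeasurable μ _ h)
  have hy' : ¬ C ≤ d x₀ y := fun h => hy (subset_toMeasurable μ _ h)
  have h₁ := hd.triangle x x₀ y
  rw [hd.symm x x₀] at h₁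
  linarith

lemma exists_mem_Lip1_forall_lt_meDist {α : Type*} [MeasurableSpace α] (μ : Measure α)
    [IsFiniteMeasure μ] {d d' : α → α → ℝ} (hd' : IsSemiDist d') {C : ℝ} {T : Set α}
    (hT : μ Tᶜ = 0) (hC : ∀ x ∈ T, ∀ y ∈ T, d x y ≤ C) {x₀ : α}
    (h : ∀ C, μ {y | C ≤ d' x₀ y} ≠ 0) {ε : ℝ} (hε : 0 < ε) :
    ∃ g ∈ Lip1 d', ∀ f ∈ Lip1 d, ε < meDist μ 0 f g := by
  obtain ⟨r, hr⟩ : ∃ r : ℕ, μ {y | d' x₀ y ≤ r} ≠ 0 := by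
    by_contra! hr
    have hU := measure_iUnion_null hr
    obtain ⟨x, -, hx⟩ := exists_mem_notMem_of_measure_ne_zero (h 0) hU
    obtain ⟨n, hn⟩ := exists_nat_ge (d' x₀ x)
    exact hx (mem_iUnion.2 ⟨n, hn⟩)
  have hr₀ : (0 : ℝ) ≤ r := r.cast_nonneg
  set R : ℝ := r + |C| + 2 * ε + 3 with hR
  have hCabs := le_abs_self C
  have hCnonneg := abs_nonneg C
  refine ⟨_, hd'.min_mem_Lip1 (hd'.apply_mem_Lip1 x₀) R, fun f hf => ?_⟩
  by_contra! hle
  have hne : {δ : ℝ | 0 < δ ∧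
      (μ {x | δ ≤ |f x - min (d' x₀ x) R|}).toReal ≤ 0 * δ}.Nonempty := by
    obtain ⟨y₀, -, hy₀⟩ := exists_mem_notMem_of_measure_ne_zero (h 0) hT
    rw [notMem_compl_iff] at hy₀
    have hf₀ := abs_nonneg (f y₀)
    refine ⟨|f y₀| + |C| + R + 1, by linarith, ?_⟩
    rw [measure_mono_null _ hT]
    · simp
    · intro x hx hxT
      simp only [mem_ofPred_eq] at hx
      have h₁ := abs_le.1 ((hf x y₀).trans (hC x hxT y₀ hy₀))
      have h₂ : min (d' x₀ x) R ≤ R := min_le_right _ _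
      have h₃ : 0 ≤ min (d' x₀ x) R := le_min (hd'.nonneg _ _) (by linarith)
      have h₄ := le_abs_self (f y₀)
      have h₅ := neg_abs_le (f y₀)
      have h₆ : |f x - min (d' x₀ x) R| ≤ |f y₀| + |C| + R :=
        abs_le.2 ⟨by linarith, by linarith⟩
      linarith
  obtain ⟨δ, ⟨-, hδ⟩, hδε⟩ := exists_lt_of_csInf_lt hne (hle.trans_lt (lt_add_one ε))
  have hδ₀ : μ {x | δ ≤ |f x - min (d' x₀ x) R|} = 0 := by
    have h₁ := le_antisymm (by simpa using hδ) ENNReal.toReal_nonneg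
    exact ((ENNReal.toReal_eq_zero_iff _).1 h₁).resolve_right (measure_ne_top _ _)
  have hnull := measure_union_null hT hδ₀
  obtain ⟨y, hy, hy'⟩ := exists_mem_notMem_of_measure_ne_zero hr hnull
  obtain ⟨z, hz, hz'⟩ := exists_mem_notMem_of_measure_ne_zero (h R) hnull
  simp only [mem_union, mem_compl_iff, mem_ofPred_eq, not_or, not_not, not_le] at hy hy' hz hz'
  have h₁ := abs_lt.1 hy'.2
  have h₂ := abs_lt.1 hz'.2
  have h₃ := (abs_le.1 ((hf z y).trans (hC z hz'.1 y hy'.1))).2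
  have h₄ : min (d' x₀ y) R ≤ r := (min_le_left _ _).trans hy
  rw [min_eq_right hz] at h₂
  linarith [h₁.1, h₁.2, h₂.1, h₂.2]

lemma HL_zero_eq_zero_of_bounded_of_unbounded {α : Type*} [MeasurableSpace α] (μ : Measure α)
    [IsFiniteMeasure μ] {d d' : α → α → ℝ} (hd' : IsSemiDist d') {C : ℝ} {T : Set α}
    (hT : μ Tᶜ = 0) (hC : ∀ x ∈ T, ∀ y ∈ T, d x y ≤ C) {x₀ : α}
    (h : ∀ C, μ {y | C ≤ d' x₀ y} ≠ 0) : HL μ 0 d d' = 0 := by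
  refine (congrArg sInf (eq_empty_of_forall_notMem fun ε hε => ?_)).trans Real.sInf_empty
  obtain ⟨g, hg, hlt⟩ := exists_mem_Lip1_forall_lt_meDist μ hd' hT hC h hε.1
  obtain ⟨f, hf, hle⟩ := hε.2.2 g hg
  exact (hlt f hf).not_ge hle

lemma HL_zero_le_zero_of_unbounded {α : Type*} [MeasurableSpace α] (μ : Measure α)
    [IsFiniteMeasure μ] {d d' : α → α → ℝ} (hd : IsSemiDist d) (hd' : IsSemiDist d') {x₀ : α}
    (h : ∀ C, μ {y | C ≤ d x₀ y} ≠ 0) (h' : ∀ C, μ {y | C ≤ d' x₀ y} ≠ 0) :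
    HL μ 0 d d' ≤ 0 := by
  refine le_of_forall_pos_le_add fun ε hε => ?_
  rw [zero_add]
  refine csInf_le ⟨0, fun _ hx => hx.1.le⟩ ⟨hε, fun f _ => ?_, fun g _ => ?_⟩
  · obtain ⟨g, hg, h₀⟩ := exists_mem_Lip1_meDist_zero_eq_zero μ hd' h' f
    exact ⟨g, hg, h₀.le.trans hε.le⟩
  · obtain ⟨f, hf, h₀⟩ := exists_mem_Lip1_meDist_zero_eq_zero μ hd h g
    exact ⟨f, hf, (meDist_comm μ 0 f g).le.trans (h₀.le.trans hε.le)⟩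

/-- With the convention `sInf ∅ = 0`, the inequality persists when no `ε` is admissible in the
definition of `□_λ(d, d')`. -/
lemma HL_le_zero_of_boxDist_set_eq_empty {α : Type*} [MeasurableSpace α] (μ : Measure α)
    [IsFiniteMeasure μ] {lam : ℝ} (hlam : 0 ≤ lam) {d d' : α → α → ℝ} (hd : IsSemiDist d)
    (hd' : IsSemiDist d')
    (hE : ∀ ε : ℝ, 0 < ε → ∀ T : Set α, MeasurableSet T →
      (μ univ).toReal - lam * ε ≤ (μ T).toReal → ¬ ∀ x ∈ T, ∀ y ∈ T, |d x y - d' x y| ≤ ε) :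
    HL μ lam d d' ≤ 0 := by
  rcases hlam.eq_or_lt with rfl | hpos
  · obtain ⟨x₀⟩ : Nonempty α := by
      by_contra hα
      rw [not_nonempty_iff] at hα
      exact hE 1 one_pos univ .univ (by simp) fun x => hα.elim x
    rcases hd.bounded_or_unbounded μ x₀ with ⟨C, T, hT, hT₀, hC⟩ | h <;>
      rcases hd'.bounded_or_unbounded μ x₀ with ⟨C', T', hT', hT₀', hC'⟩ | h'
    · refine (hE (|C| + |C'| + 1) (by positivity) (T ∩ T') (hT.inter hT') ?_
        fun x hx y hy => ?_).elim
      · have h₀ : μ (T ∩ T')ᶜ = 0 := by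
          rw [compl_inter]
          exact measure_union_null hT₀ hT₀'
        have h₁ := measure_add_measure_compl (μ := μ) (hT.inter hT')
        rw [h₀, add_zero] at h₁
        simp [h₁]
      · have h₁ := hC x hx.1 y hy.1
        have h₂ := hC' x hx.2 y hy.2
        have h₃ := hd.nonneg x y
        have h₄ := hd'.nonneg x y
        have h₅ := le_abs_self C
        have h₆ := le_abs_self C'
        exact abs_le.2 ⟨by linarith, by linarith⟩
    · exact (HL_zero_eq_zero_of_bounded_of_unbounded μ hd' hT₀ hC h').le
    · rw [HL_comm]
      exact (HL_zero_eq_zero_of_bounded_of_unbounded μ hd hT₀' hC' h).le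
    · exact HL_zero_le_zero_of_unbounded μ hd hd' h h'
  · refine (hE ((μ univ).toReal / lam + 1) (by positivity) ∅ .empty ?_ (by simp)).elim
    rw [mul_add, mul_div_cancel₀ _ hpos.ne']
    simp only [measure_empty, ENNReal.toReal_zero]
    linarith

/-- `H_λLι₁(d, d') ≤ □_λ(d, d')` for semi-distances on a finite measure space. -/
theorem HL_le_boxDist {α : Type*} [MeasurableSpace α] (μ : Measure α) [IsFiniteMeasure μ]
    (lam : ℝ) (hlam : 0 ≤ lam) (d d' : α → α → ℝ)
    (hd : IsSemiDist d) (hd' : IsSemiDist d') :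
    HL μ lam d d' ≤ boxDist μ lam d d' := by
  rcases {ε : ℝ | 0 < ε ∧ ∃ T : Set α, MeasurableSet T ∧
    (μ univ).toReal - lam * ε ≤ (μ T).toReal ∧
    ∀ x ∈ T, ∀ y ∈ T, |d x y - d' x y| ≤ ε}.eq_empty_or_nonempty with hE | hne
  · rw [boxDist, hE, Real.sInf_empty]
    exact HL_le_zero_of_boxDist_set_eq_empty μ hlam hd hd' fun ε hε T hT hμ h =>
      eq_empty_iff_forall_notMem.1 hE ε ⟨hε, T, hT, hμ, h⟩
  · refine le_csInf hne ?_
    rintro ε ⟨hε, T, hT, hμ, h⟩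
    refine csInf_le ⟨0, fun _ hx => hx.1.le⟩ ⟨hε, fun f hf => ?_, fun g hg => ?_⟩
    · exact exists_mem_Lip1_meDist_le μ hd' hε hT hμ h hf
    · obtain ⟨f, hf, hle⟩ := exists_mem_Lip1_meDist_le μ hd hε hT hμ
        (fun x hx y hy => by rw [abs_sub_comm]; exact h x hx y hy) hg
      exact ⟨f, hf, by rwa [meDist_comm]⟩
end

section
/- Let X be an mm-space with m := μ_X(X) and let φ_X : [0,m] → X be a parameter of X. Then Lip_1(φ_X*d_X) = { f ∘ φ_X : f ∈ Lip_1(d_X) }, i.e., a function g : [0,m] → ℝ is 1-Lipschitz with respect to the pseudometric φ_X*d_X if and only if g = f ∘ φ_X for some 1-Lipschitz function f : X → ℝ. -/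
open MeasureTheory Set Filter Topology

/-- `Lip_1(φX*d_X) = {f ∘ φX : f ∈ Lip_1(d_X)}` for a parameter `φX`. -/
theorem Lip1_pullback {X : Type*}
    [MetricSpace X] [CompleteSpace X] [TopologicalSpace.SeparableSpace X]
    [MeasurableSpace X] [BorelSpace X]
    (μX : Measure X) [IsFiniteMeasure μX] (m : ℝ) (hm : (μX univ).toReal = m)
    (φX : ℝ → X) (hφ : IsParameter μX m φX) :
    Lip1 (pb φX) = {g : ℝ → ℝ | ∃ f ∈ Lip1 (fun a b : X => dist a b), g = f ∘ φX} := by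
  ext g
  constructor
  · intro hg
    have hfac : Function.FactorsThrough g φX := fun s t hst =>
      sub_eq_zero.mp (abs_nonpos_iff.mp ((hg s t).trans_eq (by simp [pb, hst])))
    have hcomp : ∀ s, Function.extend φX g 0 (φX s) = g s := hfac.extend_apply 0
    have hlip : LipschitzOnWith 1 (Function.extend φX g 0) (range φX) := by
      apply LipschitzOnWith.of_dist_le_mul
      rintro _ ⟨s, rfl⟩ _ ⟨t, rfl⟩
      simpa [hcomp, Real.dist_eq, pb] using hg s t
    obtain ⟨f, hf, heq⟩ := hlip.extend_real
    refine ⟨f, fun x y => ?_, funext fun s => ?_⟩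
    · simpa [Real.dist_eq] using hf.dist_le_mul x y
    · rw [Function.comp_apply, ← heq (mem_range_self s), hcomp]
  · rintro ⟨f, hf, rfl⟩ s t
    exact hf (φX s) (φX t)
end

section
/- Let λ ≥ 0, let X and Y be mm-spaces with m := μ_X(X) = μ_Y(Y), let φ_X : [0,m] → X and φ_Y : [0,m] → Y be parameters, and let Φ : [0,m] → [0,m] be a Borel measurable map with Φ_*(𝓛) = 𝓛. Then H_λLι_1((φ_X ∘ Φ)*d_X, (φ_Y ∘ Φ)*d_Y) = H_λLι_1(φ_X*d_X, φ_Y*d_Y). -/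
open MeasureTheory Set Filter Topology

/-- The `1`-Lipschitz functions for a pulled back distance are the compositions of `φ` with
the `1`-Lipschitz functions on the target. -/
theorem mem_Lip1_pb_iff {X : Type*} [PseudoMetricSpace X] {φ : ℝ → X} {f : ℝ → ℝ} :
    f ∈ Lip1 (pb φ) ↔ ∃ F : X → ℝ, LipschitzWith 1 F ∧ f = F ∘ φ := by
  constructor
  · intro hf
    have hfac : ∀ s t, φ s = φ t → f s = f t := fun s t h => by
      have h1 : |f s - f t| ≤ dist (φ s) (φ t) := hf s t
      rw [h, dist_self] at h1
      exact sub_eq_zero.mp (abs_nonpos_iff.mp h1)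
    have hinv : ∀ s, f (Function.invFun φ (φ s)) = f s := fun s =>
      hfac _ _ (Function.invFun_eq ⟨s, rfl⟩)
    have hlip : LipschitzOnWith 1 (fun x => f (Function.invFun φ x)) (range φ) := by
      apply LipschitzOnWith.of_dist_le_mul
      rintro _ ⟨s, rfl⟩ _ ⟨t, rfl⟩
      simp only [hinv, Real.dist_eq, NNReal.coe_one, one_mul]
      exact hf s t
    obtain ⟨F, hF, hEq⟩ := hlip.extend_real
    exact ⟨F, hF, funext fun s => (hinv s).symm.trans (hEq ⟨s, rfl⟩)⟩
  · rintro ⟨F, hF, rfl⟩ s t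
    simpa [Real.dist_eq, pb] using hF.dist_le_mul (φ s) (φ t)

/-- `me_λ` is invariant under precomposition with a measure preserving map. -/
theorem meDist_comp {α β : Type*} [MeasurableSpace α] [MeasurableSpace β]
    {μ : Measure α} {ν : Measure β} {Φ : α → β} (hΦ : MeasurePreserving Φ μ ν) (lam : ℝ)
    {f g : β → ℝ} (hf : Measurable f) (hg : Measurable g) :
    meDist μ lam (f ∘ Φ) (g ∘ Φ) = meDist ν lam f g := by
  have key : ∀ ε : ℝ, μ {x | ε ≤ |(f ∘ Φ) x - (g ∘ Φ) x|} = ν {x | ε ≤ |f x - g x|} :=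
    fun ε => hΦ.measure_preimage
      (measurableSet_le measurable_const (hf.sub hg).abs).nullMeasurableSet
  simp only [meDist, key]

/-- invariance of `H_λLι₁` under precomposition with a Lebesgue-measure
preserving Borel map `Φ : [0,m] → [0,m]`. -/
theorem HL_precomp {X Y : Type*}
    [MetricSpace X] [CompleteSpace X] [TopologicalSpace.SeparableSpace X]
    [MeasurableSpace X] [BorelSpace X]
    [MetricSpace Y] [CompleteSpace Y] [TopologicalSpace.SeparableSpace Y]
    [MeasurableSpace Y] [BorelSpace Y]
    (μX : Measure X) (μY : Measure Y) [IsFiniteMeasure μX] [IsFiniteMeasure μY]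
    (lam m : ℝ) (hlam : 0 ≤ lam)
    (hmX : (μX univ).toReal = m) (hmY : (μY univ).toReal = m)
    (φX : ℝ → X) (φY : ℝ → Y) (hφX : IsParameter μX m φX) (hφY : IsParameter μY m φY)
    (Φ : ℝ → ℝ) (hΦ : Measurable Φ) (hΦL : Measure.map Φ (lebIcc m) = lebIcc m) :
    HL (lebIcc m) lam (pb (φX ∘ Φ)) (pb (φY ∘ Φ)) = HL (lebIcc m) lam (pb φX) (pb φY) := by
  have key : ∀ (F : X → ℝ) (G : Y → ℝ), LipschitzWith 1 F → LipschitzWith 1 G →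
      meDist (lebIcc m) lam (F ∘ φX ∘ Φ) (G ∘ φY ∘ Φ) =
        meDist (lebIcc m) lam (F ∘ φX) (G ∘ φY) := fun F G hF hG =>
    meDist_comp (f := F ∘ φX) (g := G ∘ φY) ⟨hΦ, hΦL⟩ lam (hF.continuous.measurable.comp hφX.1)
      (hG.continuous.measurable.comp hφY.1)
  unfold HL
  congr 1
  ext ε
  simp only [mem_ofPred_eq, mem_Lip1_pb_iff]
  refine and_congr_right fun _ => and_congr ?_ ?_
  · constructor
    · rintro h _ ⟨F, hF, rfl⟩
      obtain ⟨_, ⟨G, hG, rfl⟩, hle⟩ := h _ ⟨F, hF, rfl⟩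
      exact ⟨_, ⟨G, hG, rfl⟩, (key F G hF hG).symm.trans_le hle⟩
    · rintro h _ ⟨F, hF, rfl⟩
      obtain ⟨_, ⟨G, hG, rfl⟩, hle⟩ := h _ ⟨F, hF, rfl⟩
      exact ⟨_, ⟨G, hG, rfl⟩, (key F G hF hG).trans_le hle⟩
  · constructor
    · rintro h _ ⟨G, hG, rfl⟩
      obtain ⟨_, ⟨F, hF, rfl⟩, hle⟩ := h _ ⟨G, hG, rfl⟩
      exact ⟨_, ⟨F, hF, rfl⟩, (key F G hF hG).symm.trans_le hle⟩
    · rintro h _ ⟨G, hG, rfl⟩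
      obtain ⟨_, ⟨F, hF, rfl⟩, hle⟩ := h _ ⟨G, hG, rfl⟩
      exact ⟨_, ⟨F, hF, rfl⟩, (key F G hF hG).trans_le hle⟩
end

section
/- Let X be an mm-space with m := μ_X(X) and let φ_X : [0,m] → X and ψ_X : [0,m] → X be two parameters of X. Then for any ε > 0 there exist Borel measurable maps Φ_1, Φ_2 : [0,m] → [0,m] with (Φ_1)_*(𝓛) = 𝓛 and (Φ_2)_*(𝓛) = 𝓛 such that H_0Lι_1((φ_X ∘ Φ_1)*d_X, (ψ_X ∘ Φ_2)*d_X) < ε. -/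
open MeasureTheory Set Filter Topology

open ProbabilityTheory in
/-- Two maps with the same distribution can be coupled so as to agree almost surely. -/
theorem exists_coupling_ae_eq {Ω Ω' X : Type*} [MeasurableSpace Ω] [StandardBorelSpace Ω]
    [Nonempty Ω] [MeasurableSpace Ω'] [StandardBorelSpace Ω'] [Nonempty Ω'] [MeasurableSpace X]
    [MeasurableEq X] {μ : Measure Ω} {ν : Measure Ω'} [IsFiniteMeasure μ]
    [IsFiniteMeasure ν] {f : Ω → X} {g : Ω' → X} (hf : Measurable f) (hg : Measurable g)
    (h : μ.map f = ν.map g) :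
    ∃ π : Measure (Ω × Ω'), π.map Prod.fst = μ ∧ π.map Prod.snd = ν ∧
      ∀ᵐ p ∂π, f p.1 = g p.2 := by
  set κ := condDistrib (id : Ω → Ω) f μ
  set η := condDistrib (id : Ω' → Ω') g ν
  set ρ : Measure (X × Ω × Ω') := μ.map f ⊗ₘ (κ ×ₖ η) with hρ
  have h₁ : ρ.map (Prod.map id Prod.fst) = μ.map fun a ↦ (f a, a) := by
    rw [hρ, ← Measure.compProd_map measurable_fst, ← Kernel.fst_eq, Kernel.fst_prod,
      compProd_map_condDistrib aemeasurable_id]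
    rfl
  have h₂ : ρ.map (Prod.map id Prod.snd) = ν.map fun a ↦ (g a, a) := by
    rw [hρ, ← Measure.compProd_map measurable_snd, ← Kernel.snd_eq, Kernel.snd_prod, h,
      compProd_map_condDistrib aemeasurable_id]
    rfl
  have ae₁ : ∀ᵐ p ∂ρ, p.1 = f p.2.1 := by
    have : ∀ᵐ q ∂ρ.map (Prod.map id Prod.fst), q.1 = f q.2 := by
      rw [h₁, ae_map_iff (by fun_prop) (measurableSet_eq_fun (by fun_prop) (by fun_prop))]
      simp
    exact ae_of_ae_map (by fun_prop) this
  have ae₂ : ∀ᵐ p ∂ρ, p.1 = g p.2.2 := by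
    have : ∀ᵐ q ∂ρ.map (Prod.map id Prod.snd), q.1 = g q.2 := by
      rw [h₂, ae_map_iff (by fun_prop) (measurableSet_eq_fun (by fun_prop) (by fun_prop))]
      simp
    exact ae_of_ae_map (by fun_prop) this
  refine ⟨ρ.map Prod.snd, ?_, ?_, ?_⟩
  · have := congrArg (Measure.map Prod.snd) h₁
    rw [Measure.map_map (by fun_prop) (by fun_prop),
      Measure.map_map (by fun_prop) (by fun_prop)] at this
    rw [Measure.map_map (by fun_prop) (by fun_prop)]
    exact this.trans Measure.map_id
  · have := congrArg (Measure.map Prod.snd) h₂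
    rw [Measure.map_map (by fun_prop) (by fun_prop),
      Measure.map_map (by fun_prop) (by fun_prop)] at this
    rw [Measure.map_map (by fun_prop) (by fun_prop)]
    exact this.trans Measure.map_id
  · rw [ae_map_iff (by fun_prop) (measurableSet_eq_fun (by fun_prop) (by fun_prop))]
    filter_upwards [ae₁, ae₂] with p hp hp'
    rw [← hp, hp']

theorem lebIcc_univ (m : ℝ) : lebIcc m univ = ENNReal.ofReal m := by
  simp [lebIcc]

instance isFiniteMeasure_lebIcc (m : ℝ) : IsFiniteMeasure (lebIcc m) :=
  ⟨by simp [lebIcc_univ]⟩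

theorem map_projIcc_div_lebIcc {m : ℝ} (hm : 0 < m) :
    (lebIcc m).map (fun s ↦ projIcc (0 : ℝ) 1 zero_le_one (s / m)) =
      ENNReal.ofReal m • (volume : Measure unitInterval) := by
  have hu : Measurable (fun s ↦ projIcc (0 : ℝ) 1 zero_le_one (s / m)) :=
    (continuous_projIcc.comp (continuous_id.div_const m)).measurable
  ext S hS
  have key : (fun s ↦ projIcc (0 : ℝ) 1 zero_le_one (s / m)) ⁻¹' S ∩ Icc 0 m =
      (fun s ↦ m⁻¹ * s) ⁻¹' (Subtype.val '' S) := by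
    ext s
    have hs : s ∈ Icc 0 m ↔ s / m ∈ Icc (0 : ℝ) 1 := by
      simp [mem_Icc, le_div_iff₀ hm, div_le_iff₀ hm]
    simp only [mem_inter_iff, mem_preimage, mem_image, Subtype.exists, hs]
    rw [show m⁻¹ * s = s / m by ring]
    constructor
    · rintro ⟨h₁, h₂⟩
      exact ⟨s / m, h₂, by rwa [projIcc_of_mem _ h₂] at h₁, rfl⟩
    · rintro ⟨t, ht, htS, rfl⟩
      exact ⟨by rwa [projIcc_of_mem _ ht], ht⟩
  rw [Measure.map_apply hu hS, lebIcc, Measure.restrict_apply (hu hS), key,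
    Real.volume_preimage_mul_left (inv_ne_zero hm.ne'), inv_inv, abs_of_pos hm,
    Measure.smul_apply, unitInterval.volume_apply, smul_eq_mul]

/-- Every finite measure of total mass `m` on a standard Borel space has a parameter. -/
theorem exists_measurable_map_lebIcc_eq {Y : Type*} [MeasurableSpace Y] [StandardBorelSpace Y]
    [Nonempty Y] {m : ℝ} (π : Measure Y) (hπ : π univ = ENNReal.ofReal m) :
    ∃ f : ℝ → Y, Measurable f ∧ (lebIcc m).map f = π := by
  rcases le_or_gt m 0 with hm | hm
  · rw [ENNReal.ofReal_of_nonpos hm, Measure.measure_univ_eq_zero] at hπ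
    have h0 : lebIcc m = 0 := by
      rw [← Measure.measure_univ_eq_zero, lebIcc_univ, ENNReal.ofReal_of_nonpos hm]
    exact ⟨fun _ ↦ Classical.arbitrary Y, measurable_const, by simp [h0, hπ]⟩
  · have hm0 : ENNReal.ofReal m ≠ 0 := by simpa using hm
    have : IsProbabilityMeasure ((ENNReal.ofReal m)⁻¹ • π) :=
      ⟨by simp [hπ, ENNReal.inv_mul_cancel hm0]⟩
    obtain ⟨f, hf, hfπ⟩ := ((ENNReal.ofReal m)⁻¹ • π).exists_measurable_map_eq
    have hu : Measurable (fun s ↦ projIcc (0 : ℝ) 1 zero_le_one (s / m)) :=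
      (continuous_projIcc.comp (continuous_id.div_const m)).measurable
    refine ⟨f ∘ fun s ↦ projIcc (0 : ℝ) 1 zero_le_one (s / m), hf.comp hu, ?_⟩
    rw [← Measure.map_map hf hu, map_projIcc_div_lebIcc hm, Measure.map_smul, hfπ, smul_smul,
      ENNReal.mul_inv_cancel hm0 ENNReal.ofReal_ne_top, one_smul]

/-- A function that is `1`-Lipschitz for the pullback `p*d_X` factors through `p`. -/
theorem exists_lipschitzWith_comp_eq_of_mem_Lip1_pb {X : Type*} [PseudoMetricSpace X] {p : ℝ → X}
    {f : ℝ → ℝ} (hf : f ∈ Lip1 (pb p)) : ∃ F : X → ℝ, LipschitzWith 1 F ∧ f = F ∘ p := by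
  have hp : ∀ x ∈ range p, p (Function.invFun p x) = x := fun x hx ↦ Function.invFun_eq hx
  have hL : LipschitzOnWith 1 (f ∘ Function.invFun p) (range p) := by
    refine LipschitzOnWith.of_dist_le_mul fun x hx y hy ↦ ?_
    simpa [Real.dist_eq, pb, hp x hx, hp y hy] using
      hf (Function.invFun p x) (Function.invFun p y)
  obtain ⟨F, hF, hFe⟩ := hL.extend_real
  refine ⟨F, hF, funext fun s ↦ ?_⟩
  have hs := hf s (Function.invFun p (p s))
  rw [pb, hp _ (mem_range_self s), dist_self] at hs
  rw [Function.comp_apply, ← hFe (mem_range_self s)]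
  exact sub_eq_zero.1 (abs_nonpos_iff.1 hs)

theorem LipschitzWith.comp_mem_Lip1_pb {X : Type*} [PseudoMetricSpace X] {F : X → ℝ}
    (hF : LipschitzWith 1 F) (p : ℝ → X) : F ∘ p ∈ Lip1 (pb p) := fun s t ↦ by
  simpa [Real.dist_eq, pb] using hF.dist_le_mul (p s) (p t)

theorem meDist_le_of_ae_eq {α : Type*} [MeasurableSpace α] {μ : Measure α} {f g : α → ℝ}
    (h : f =ᵐ[μ] g) {δ : ℝ} (hδ : 0 < δ) : meDist μ 0 f g ≤ δ := by
  refine csInf_le ⟨0, fun _ hx ↦ hx.1.le⟩ ⟨hδ, ?_⟩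
  have : μ {x | δ ≤ |f x - g x|} = 0 := by
    refine measure_mono_null ?_ (ae_iff.1 h)
    intro x hx hxe
    rw [mem_ofPred_eq, hxe, sub_self, abs_zero] at hx
    exact hx.not_gt hδ
  simp [this]

theorem HL_pb_le_of_ae_eq {X : Type*} [PseudoMetricSpace X] {μ : Measure ℝ} {p q : ℝ → X}
    (h : p =ᵐ[μ] q) {δ : ℝ} (hδ : 0 < δ) : HL μ 0 (pb p) (pb q) ≤ δ := by
  refine csInf_le ⟨0, fun _ hx ↦ hx.1.le⟩ ⟨hδ, fun f hf ↦ ?_, fun g hg ↦ ?_⟩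
  · obtain ⟨F, hF, rfl⟩ := exists_lipschitzWith_comp_eq_of_mem_Lip1_pb hf
    exact ⟨F ∘ q, hF.comp_mem_Lip1_pb q, meDist_le_of_ae_eq (h.fun_comp F) hδ⟩
  · obtain ⟨F, hF, rfl⟩ := exists_lipschitzWith_comp_eq_of_mem_Lip1_pb hg
    exact ⟨F ∘ p, hF.comp_mem_Lip1_pb p, meDist_le_of_ae_eq (h.fun_comp F) hδ⟩

/-- any two parameters of an mm-space can be made `H_0Lι₁`-close by
precomposing with Lebesgue-measure preserving Borel maps. -/
theorem parameters_HL_close {X : Type*}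
    [MetricSpace X] [CompleteSpace X] [TopologicalSpace.SeparableSpace X]
    [MeasurableSpace X] [BorelSpace X]
    (μX : Measure X) [IsFiniteMeasure μX] (m : ℝ) (hm : (μX univ).toReal = m)
    (φX ψX : ℝ → X) (hφ : IsParameter μX m φX) (hψ : IsParameter μX m ψX)
    (ε : ℝ) (hε : 0 < ε) :
    ∃ Φ₁ Φ₂ : ℝ → ℝ, Measurable Φ₁ ∧ Measurable Φ₂ ∧
      Measure.map Φ₁ (lebIcc m) = lebIcc m ∧ Measure.map Φ₂ (lebIcc m) = lebIcc m ∧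
      HL (lebIcc m) 0 (pb (φX ∘ Φ₁)) (pb (ψX ∘ Φ₂)) < ε := by
  have : SecondCountableTopology X := UniformSpace.secondCountable_of_separable X
  obtain ⟨hφm, hφμ⟩ := hφ
  obtain ⟨hψm, hψμ⟩ := hψ
  obtain ⟨π, hπ₁, hπ₂, hπ⟩ := exists_coupling_ae_eq hφm hψm (hφμ.trans hψμ.symm)
  have hπu : π univ = ENNReal.ofReal m := by
    rw [← lebIcc_univ, ← hπ₁, Measure.map_apply measurable_fst MeasurableSet.univ, preimage_univ]
  obtain ⟨Φ, hΦ, hΦπ⟩ := exists_measurable_map_lebIcc_eq π hπu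
  refine ⟨fun s ↦ (Φ s).1, fun s ↦ (Φ s).2, hΦ.fst, hΦ.snd, ?_, ?_, ?_⟩
  · exact (Measure.map_map measurable_fst hΦ).symm.trans (hΦπ ▸ hπ₁)
  · exact (Measure.map_map measurable_snd hΦ).symm.trans (hΦπ ▸ hπ₂)
  · rw [← hΦπ] at hπ
    have hΦe : φX ∘ (fun s ↦ (Φ s).1) =ᵐ[lebIcc m] ψX ∘ fun s ↦ (Φ s).2 :=
      ae_of_ae_map hΦ.aemeasurable hπ
    exact (HL_pb_le_of_ae_eq hΦe (half_pos hε)).trans_lt (half_lt_self hε)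
end
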